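/- Let T be an ABC-tile having exactly 14 neighbors. Then for every neighbor α of T, the set L_α = ⋃_{β ∈ ℤ³, β ∉ {0, α}} (T ∩ (T + α) ∩ (T + β)) is a simple closed curve, i.e. it is homeomorphic to the unit circle {x ∈ ℝ² : |x| = 1}. -/

import Mathlib

open MeasureTheory

noncomputable def Mmat (A B C : ℤ) : Matrix (Fin 3) (Fin 3) ℝ :=
  !![0, 0, -(C : ℝ); 1, 0, -(B : ℝ); 0, 1, -(A : ℝ)]

def Ddig (C : ℤ) : Set (Fin 3 → ℝ) :=
  {d | ∃ i : ℤ, 0 ≤ i ∧ i < C ∧ d = ![(i : ℝ), 0, 0]}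

def toR (α : Fin 3 → ℤ) : Fin 3 → ℝ := fun i => (α i : ℝ)

def tileTranslate (v : Fin 3 → ℝ) (T : Set (Fin 3 → ℝ)) : Set (Fin 3 → ℝ) :=
  (fun x => x + v) '' T

def IsABCTile (A B C : ℤ) (T : Set (Fin 3 → ℝ)) : Prop :=
  1 ≤ A ∧ A ≤ B ∧ B < C ∧
  T.Nonempty ∧ IsCompact T ∧ 0 < volume T ∧
  (Mmat A B C).mulVec '' T = ⋃ d ∈ Ddig C, tileTranslate d T

def Neighbors (T : Set (Fin 3 → ℝ)) : Set (Fin 3 → ℤ) :=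
  {α | α ≠ 0 ∧ (T ∩ tileTranslate (toR α) T).Nonempty}



/-! ## Abstract part: graph-directed chains -/

structure Sys {ι E : Type*} (n : ι → ℕ) (ch : ι → ℕ → ι) (sp : ι → Bool)
    (X : ι → Set E) (f : ι → ℕ → E → E) (a : ι → Bool → E) (D : ℕ → E → E → Prop) : Prop where
  cover : ∀ v x, x ∈ X v ↔ ∃ i, i < n v ∧ ∃ x' ∈ X (ch v i), x = f v i x'
  inj : ∀ v i x y, f v i x = f v i y → x = y
  mem : ∀ v b, a v b ∈ X v
  adj : ∀ v i x y, i + 1 < n v → x ∈ X (ch v i) → y ∈ X (ch v (i+1)) →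
    f v i x = f v (i+1) y → x = a (ch v i) true ∧ y = a (ch v (i+1)) false
  adjp : ∀ v i, i + 1 < n v → f v i (a (ch v i) true) = f v (i+1) (a (ch v (i+1)) false)
  far : ∀ v i j x y, i + 2 ≤ j → j < n v → x ∈ X (ch v i) → y ∈ X (ch v j) → f v i x ≠ f v j y
  ends : ∀ v b, a v b = f v (if b then 0 else n v - 1)
    (a (ch v (if b then 0 else n v - 1)) (xor (sp v) b))
  endu : ∀ v b i x, i < n v → x ∈ X (ch v i) → f v i x = a v b → i = if b then 0 else n v - 1
  npos : ∀ v, 0 < n v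
  D0 : ∀ v x y, x ∈ X v → y ∈ X v → D 0 x y
  Dsymm : ∀ k x y, D k x y → D k y x
  Dstep : ∀ v i k x y, D k x y → D (k+1) (f v i x) (f v i y)
  sep : ∀ x y, (∀ k, ∃ z, D k x z ∧ D k z y) → x = y

/-- finite level approximations of the graph of the homeomorphism -/
def GRel {ι E F : Type*} (n : ι → ℕ) (ch : ι → ℕ → ι)
    (X : ι → Set E) (f : ι → ℕ → E → E) (Y : ι → Set F) (g : ι → ℕ → F → F) :
    ℕ → ι → Set (E × F)
  | 0, v => X v ×ˢ Y v
  | k+1, v => ⋃ i ∈ Set.Iio (n v), (Prod.map (f v i) (g v i)) '' GRel n ch X f Y g k (ch v i)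

section Abstract
variable {ι E F : Type*} {n : ι → ℕ} {ch : ι → ℕ → ι} {sp : ι → Bool}
  {X : ι → Set E} {f : ι → ℕ → E → E} {a : ι → Bool → E} {D : ℕ → E → E → Prop}
  {Y : ι → Set F} {g : ι → ℕ → F → F} {b : ι → Bool → F} {D' : ℕ → F → F → Prop}

theorem mem_GRel_succ {k : ℕ} {v : ι} {x : E} {y : F} :
    (x, y) ∈ GRel n ch X f Y g (k+1) v ↔ ∃ i, i < n v ∧ ∃ x' y',
      (x', y') ∈ GRel n ch X f Y g k (ch v i) ∧ x = f v i x' ∧ y = g v i y' := by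
  simp only [GRel, Set.mem_iUnion, Set.mem_Iio, Set.mem_image, Prod.exists, Prod.map_apply,
    Prod.mk.injEq, exists_prop]
  constructor
  · rintro ⟨i, hi, x', y', h, rfl, rfl⟩; exact ⟨i, hi, x', y', h, rfl, rfl⟩
  · rintro ⟨i, hi, x', y', h, rfl, rfl⟩; exact ⟨i, hi, x', y', h, rfl, rfl⟩

theorem GRel_swap (k : ℕ) : ∀ (v : ι) (x : E) (y : F),
    (x, y) ∈ GRel n ch X f Y g k v ↔ (y, x) ∈ GRel n ch Y g X f k v := by
  induction k with
  | zero => intro v x y; simp [GRel, and_comm]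
  | succ k ih =>
    intro v x y
    rw [mem_GRel_succ, mem_GRel_succ]
    constructor
    · rintro ⟨i, hi, x', y', h, hx, hy⟩; exact ⟨i, hi, y', x', (ih _ _ _).1 h, hy, hx⟩
    · rintro ⟨i, hi, x', y', h, hx, hy⟩; exact ⟨i, hi, y', x', (ih _ _ _).2 h, hy, hx⟩

theorem GRel_sub (hX : Sys n ch sp X f a D) (hY : Sys n ch sp Y g b D') (k : ℕ) :
    ∀ (v : ι) (x : E) (y : F), (x, y) ∈ GRel n ch X f Y g k v → x ∈ X v ∧ y ∈ Y v := by
  induction k with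
  | zero => intro v x y h; simpa [GRel] using h
  | succ k ih =>
    intro v x y h
    have hin := h
    clear h
    obtain ⟨i, hi, x', y', h, rfl, rfl⟩ := mem_GRel_succ.1 hin
    obtain ⟨h1, h2⟩ := ih _ _ _ h
    exact ⟨(hX.cover _ _).2 ⟨i, hi, x', h1, rfl⟩, (hY.cover _ _).2 ⟨i, hi, y', h2, rfl⟩⟩

theorem GRel_anti (hX : Sys n ch sp X f a D) (hY : Sys n ch sp Y g b D') (k : ℕ) :
    ∀ (v : ι) (x : E) (y : F), (x, y) ∈ GRel n ch X f Y g (k+1) v → (x, y) ∈ GRel n ch X f Y g k v := by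
  induction k with
  | zero => intro v x y h; exact ⟨(GRel_sub hX hY _ _ _ _ h).1, (GRel_sub hX hY _ _ _ _ h).2⟩
  | succ k ih =>
    intro v x y h
    have hin := h
    clear h
    obtain ⟨i, hi, x', y', h, rfl, rfl⟩ := mem_GRel_succ.1 hin
    exact mem_GRel_succ.2 ⟨i, hi, x', y', ih _ _ _ h, rfl, rfl⟩

theorem GRel_total (hX : Sys n ch sp X f a D) (hY : Sys n ch sp Y g b D') (k : ℕ) :
    ∀ (v : ι) (x : E), x ∈ X v → ∃ y, (x, y) ∈ GRel n ch X f Y g k v := by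
  induction k with
  | zero => intro v x h; exact ⟨b v true, h, hY.mem _ _⟩
  | succ k ih =>
    intro v x h
    have hin := h
    clear h
    obtain ⟨i, hi, x', h, rfl⟩ := (hX.cover _ _).1 hin
    obtain ⟨y, hy⟩ := ih _ _ h
    exact ⟨g v i y, mem_GRel_succ.2 ⟨i, hi, x', y, hy, rfl, rfl⟩⟩

theorem GRel_ends_mem (hX : Sys n ch sp X f a D) (hY : Sys n ch sp Y g b D') (k : ℕ) :
    ∀ (v : ι) (e : Bool), (a v e, b v e) ∈ GRel n ch X f Y g k v := by
  induction k with
  | zero => intro v e; exact ⟨hX.mem _ _, hY.mem _ _⟩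
  | succ k ih =>
    intro v e
    refine mem_GRel_succ.2 ⟨if e then 0 else n v - 1, ?_, _, _, ih _ _, hX.ends v e, hY.ends v e⟩
    have := hX.npos v
    split_ifs <;> omega

theorem GRel_ends (hX : Sys n ch sp X f a D) (hY : Sys n ch sp Y g b D') (k : ℕ) :
    ∀ (v : ι) (e : Bool) (y : F), (a v e, y) ∈ GRel n ch X f Y g k v → D' k y (b v e) := by
  induction k with
  | zero => intro v e y h; exact hY.D0 v _ _ h.2 (hY.mem _ _)
  | succ k ih =>
    intro v e y h
    have hin := h
    clear h
    obtain ⟨i, hi, x', y', h, hx, rfl⟩ := mem_GRel_succ.1 hin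
    have hm := GRel_sub hX hY _ _ _ _ h
    have := hX.endu v e i x' hi hm.1 hx.symm
    have h2 := hX.ends v e
    rw [hY.ends v e]
    rw [← this] at h2 ⊢
    have h3 := hX.inj _ _ _ _ (hx.symm.trans h2)
    rw [h3] at h
    exact hY.Dstep _ _ _ _ _ (ih _ _ _ h)

theorem GRel_bound (hX : Sys n ch sp X f a D) (hY : Sys n ch sp Y g b D') (k : ℕ) :
    ∀ (v : ι) (x : E) (y y2 : F), (x, y) ∈ GRel n ch X f Y g k v →
      (x, y2) ∈ GRel n ch X f Y g k v → ∃ z, D' k y z ∧ D' k z y2 := by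
  induction k with
  | zero => intro v x y y2 h h2; exact ⟨y, hY.D0 v _ _ h.2 h.2, hY.D0 v _ _ h.2 h2.2⟩
  | succ k ih =>
    have key : ∀ v i x' y' j x2 y2', i < j → j < n v → (x', y') ∈ GRel n ch X f Y g k (ch v i) →
        (x2, y2') ∈ GRel n ch X f Y g k (ch v j) → f v i x' = f v j x2 →
        ∃ z, D' (k+1) (g v i y') z ∧ D' (k+1) z (g v j y2') := by
      intro v i x' y' j x2 y2' hij hj h1 h2 he
      have m1 := GRel_sub hX hY _ _ _ _ h1
      have m2 := GRel_sub hX hY _ _ _ _ h2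
      rcases Nat.lt_or_ge (i+1) j with h | h
      · exact absurd he (hX.far v i j _ _ h hj m1.1 m2.1)
      · obtain rfl : j = i + 1 := by omega
        obtain ⟨r1, r2⟩ := hX.adj v i x' x2 hj m1.1 m2.1 he
        subst r1 r2
        refine ⟨_, hY.Dstep _ _ _ _ _ (GRel_ends hX hY _ _ _ _ h1), ?_⟩
        rw [hY.adjp v i hj]
        exact hY.Dstep _ _ _ _ _ (hY.Dsymm _ _ _ (GRel_ends hX hY _ _ _ _ h2))
    intro v x y y2 h h2
    have hin := h
    clear h
    obtain ⟨i, hi, x', y', h, rfl, rfl⟩ := mem_GRel_succ.1 hin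
    have hin2 := h2
    clear h2
    obtain ⟨j, hj, x2', y2', h2, hx, rfl⟩ := mem_GRel_succ.1 hin2
    rcases lt_trichotomy i j with hij | rfl | hij
    · exact key v i x' y' j x2' y2' hij hj h h2 hx
    · have := hX.inj _ _ _ _ hx
      subst this
      obtain ⟨z, h3, h4⟩ := ih _ _ _ _ h h2
      exact ⟨_, hY.Dstep _ _ _ _ _ h3, hY.Dstep _ _ _ _ _ h4⟩
    · obtain ⟨z, h3, h4⟩ := key v j x2' y2' i x' y' hij hi h2 h hx.symm
      exact ⟨z, hY.Dsymm _ _ _ h4, hY.Dsymm _ _ _ h3⟩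

variable [TopologicalSpace E] [T2Space E] [TopologicalSpace F] [T2Space F]

theorem GRel_compact (hXc : ∀ v, IsCompact (X v)) (hYc : ∀ v, IsCompact (Y v))
    (hf : ∀ v i, Continuous (f v i)) (hg : ∀ v i, Continuous (g v i)) (k : ℕ) :
    ∀ v, IsCompact (GRel n ch X f Y g k v) := by
  induction k with
  | zero => intro v; exact (hXc v).prod (hYc v)
  | succ k ih =>
    intro v
    exact (Set.finite_Iio (n v)).isCompact_biUnion
      (fun i _ => (ih (ch v i)).image ((hf v i).prodMap (hg v i)))

theorem GRel_total_inf (hX : Sys n ch sp X f a D) (hY : Sys n ch sp Y g b D')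
    (hXc : ∀ v, IsCompact (X v)) (hYc : ∀ v, IsCompact (Y v))
    (hf : ∀ v i, Continuous (f v i)) (hg : ∀ v i, Continuous (g v i)) (v : ι) (x : E)
    (hx : x ∈ X v) : ∃ y, ∀ k, (x, y) ∈ GRel n ch X f Y g k v := by
  have cl : ∀ k, IsClosed ((fun y : F => (x, y)) ⁻¹' GRel n ch X f Y g k v) := fun k =>
    (GRel_compact hXc hYc hf hg k v).isClosed.preimage (by fun_prop)
  have := IsCompact.nonempty_iInter_of_sequence_nonempty_isCompact_isClosed
    (fun k => (fun y : F => (x, y)) ⁻¹' GRel n ch X f Y g k v)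
    (fun k y hy => GRel_anti hX hY k v x y hy)
    (fun k => GRel_total hX hY k v x hx)
    ((hYc v).of_isClosed_subset (cl 0) (fun y hy => (GRel_sub hX hY _ _ _ _ hy).2)) cl
  obtain ⟨y, hy⟩ := this
  exact ⟨y, fun k => Set.mem_iInter.1 hy k⟩

theorem abstract_homeo (hX : Sys n ch sp X f a D) (hY : Sys n ch sp Y g b D')
    (hXc : ∀ v, IsCompact (X v)) (hYc : ∀ v, IsCompact (Y v))
    (hf : ∀ v i, Continuous (f v i)) (hg : ∀ v i, Continuous (g v i)) (v : ι) :
    ∃ γ : F → E, ContinuousOn γ (Y v) ∧ Set.InjOn γ (Y v) ∧ γ '' (Y v) = X v ∧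
      ∀ e, γ (b v e) = a v e := by
  classical
  have tot1 := GRel_total_inf hX hY hXc hYc hf hg v
  have tot2 := GRel_total_inf hY hX hYc hXc hg hf v
  have u1 : ∀ x y y2, (∀ k, (x, y) ∈ GRel n ch X f Y g k v) →
      (∀ k, (x, y2) ∈ GRel n ch X f Y g k v) → y = y2 := fun x y y2 h h2 =>
    hY.sep _ _ (fun k => GRel_bound hX hY k v x y y2 (h k) (h2 k))
  have u2 : ∀ y x x2, (∀ k, (x, y) ∈ GRel n ch X f Y g k v) →
      (∀ k, (x2, y) ∈ GRel n ch X f Y g k v) → x = x2 := fun y x x2 h h2 =>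
    hX.sep _ _ (fun k => GRel_bound hY hX k v y x x2 ((GRel_swap _ _ _ _).1 (h k))
      ((GRel_swap _ _ _ _).1 (h2 k)))
  have tot2' : ∀ y, ∃ x, y ∈ Y v → ∀ k, (x, y) ∈ GRel n ch X f Y g k v := by
    intro y
    by_cases hy : y ∈ Y v
    · obtain ⟨x, hx⟩ := tot2 y hy
      exact ⟨x, fun _ k => (GRel_swap _ _ _ _).2 (hx k)⟩
    · exact ⟨a v true, fun h => absurd h hy⟩
  choose γ hγ using tot2'
  refine ⟨γ, ?_, ?_, ?_, ?_⟩
  · -- closed graph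
    rw [continuousOn_iff_continuous_domRestrict]
    let G : Set (E × F) := ⋂ k, GRel n ch X f Y g k v
    have hG : IsCompact G := by
      have c := GRel_compact (n := n) (ch := ch) hXc hYc hf hg
      exact (c 0 v).of_isClosed_subset (isClosed_iInter fun k => (c k v).isClosed)
        (Set.iInter_subset _ 0)
    rw [continuous_iff_isClosed]
    intro s hs
    have : (Y v).domRestrict γ ⁻¹' s = Subtype.val ⁻¹' (Prod.snd '' (G ∩ Prod.fst ⁻¹' s)) := by
      ext ⟨y, hy⟩
      simp only [Set.mem_preimage, Set.domRestrict_apply, Set.mem_image, Set.mem_inter_iff,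
        Prod.exists, exists_eq_right]
      constructor
      · intro h; exact ⟨γ y, Set.mem_iInter.2 (hγ y hy), h⟩
      · rintro ⟨x, hx, hxs⟩
        rwa [u2 y (γ y) x (hγ y hy) (Set.mem_iInter.1 hx)]
    rw [this]
    refine IsClosed.preimage continuous_subtype_val ?_
    exact ((hG.inter_right (hs.preimage continuous_fst)).image continuous_snd).isClosed
  · intro y hy y2 hy2 he
    refine u1 (γ y) y y2 (hγ y hy) ?_
    rw [he]; exact hγ y2 hy2
  · ext x
    constructor
    · rintro ⟨y, hy, rfl⟩; exact (GRel_sub hX hY _ _ _ _ (hγ y hy 0)).1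
    · intro hx
      obtain ⟨y, hy⟩ := tot1 x hx
      have hyv := (GRel_sub hX hY _ _ _ _ (hy 0)).2
      exact ⟨y, hyv, u2 y _ _ (hγ y hyv) hy⟩
  · intro e
    exact u2 (b v e) _ _ (hγ _ (hY.mem _ _)) (fun k => GRel_ends_mem hX hY k v e)

end Abstract

/-! ### The model system of intervals -/

section Interval
variable {ι : Type*} (n : ι → ℕ) (ch : ι → ℕ → ι) (sp : ι → Bool) (l : ι → ℝ)

noncomputable def Off (v : ι) (i : ℕ) : ℝ := ∑ j ∈ Finset.range i, l (ch v j)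

noncomputable def gI (v : ι) (i : ℕ) (t : ℝ) : ℝ :=
  if sp v then l v - l v / Off ch l v (n v) * (Off ch l v i + t)
  else l v / Off ch l v (n v) * (Off ch l v i + t)

noncomputable def bI (v : ι) (e : Bool) : ℝ := if e then l v else 0

variable {n ch sp l}

theorem Off_lt (hl : ∀ v, 0 < l v) (v : ι) {i j : ℕ} (h : i < j) :
    Off ch l v i + l (ch v i) ≤ Off ch l v j := by
  induction j, h using Nat.le_induction with
  | base => simp [Off, Finset.sum_range_succ]
  | succ m hm ih =>
    have := hl (ch v m)
    simp only [Off, Finset.sum_range_succ] at ih ⊢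
    linarith

theorem Off_find (v : ι) (m : ℕ) (hm : 0 < m) (s : ℝ) (h0 : 0 ≤ s) (h1 : s ≤ Off ch l v m) :
    ∃ i, i < m ∧ Off ch l v i ≤ s ∧ s ≤ Off ch l v i + l (ch v i) := by
  induction m, hm using Nat.le_induction with
  | base => exact ⟨0, by norm_num, by simpa [Off] using h0, by simpa [Off] using h1⟩
  | succ m hm ih =>
    by_cases h : s ≤ Off ch l v m
    · obtain ⟨i, hi, h2⟩ := ih h
      exact ⟨i, by omega, h2⟩
    · refine ⟨m, by omega, by linarith, ?_⟩
      simpa [Off, Finset.sum_range_succ] using h1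

theorem interval_sys (hn : ∀ v, 0 < n v) (hsp : ∀ v, sp v = false → n v = 1)
    (hl : ∀ v, 0 < l v) (hl8 : ∀ v, l v ≤ 8)
    (hc : ∀ v, l v ≤ 7/8 * Off ch l v (n v)) :
    Sys n ch sp (fun v => Set.Icc 0 (l v)) (gI n ch sp l) (bI l)
      (fun k s t => |s - t| ≤ 8 * (7/8 : ℝ)^k) := by
  have Opos : ∀ v, 0 < Off ch l v (n v) := fun v => by have := hl v; have := hc v; linarith
  have rpos : ∀ v, 0 < l v / Off ch l v (n v) := fun v => div_pos (hl v) (Opos v)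
  have rle : ∀ v, l v / Off ch l v (n v) ≤ 7/8 := fun v => by
    rw [div_le_iff₀ (Opos v)]; exact hc v
  have rmul : ∀ v, l v / Off ch l v (n v) * Off ch l v (n v) = l v := fun v =>
    div_mul_cancel₀ _ (Opos v).ne'
  have O0 : ∀ v, Off ch l v 0 = 0 := fun v => by simp [Off]
  have Onn : ∀ v i, 0 ≤ Off ch l v i := fun v i => by
    unfold Off; exact Finset.sum_nonneg fun j _ => (hl _).le
  have Olast : ∀ v, Off ch l v (n v - 1) + l (ch v (n v - 1)) = Off ch l v (n v) := fun v => by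
    obtain ⟨m, hm⟩ : ∃ m, n v = m + 1 := ⟨n v - 1, by have := hn v; omega⟩
    rw [hm]; simp [Off, Finset.sum_range_succ]
  have Osucc : ∀ v i, Off ch l v (i+1) = Off ch l v i + l (ch v i) := fun v i => by
    simp [Off, Finset.sum_range_succ]
  have geq : ∀ v i j s t, gI n ch sp l v i s = gI n ch sp l v j t →
      Off ch l v i + s = Off ch l v j + t := by
    intro v i j s t h
    unfold gI at h
    have h2 : l v / Off ch l v (n v) * (Off ch l v i + s)
        = l v / Off ch l v (n v) * (Off ch l v j + t) := by
      split_ifs at h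
      · linarith
      · exact h
    exact mul_left_cancel₀ (rpos v).ne' h2
  have geq' : ∀ v i j s t, Off ch l v i + s = Off ch l v j + t →
      gI n ch sp l v i s = gI n ch sp l v j t := by
    intro v i j s t h
    unfold gI; rw [h]
  refine ⟨?_, ?_, ?_, ?_, ?_, ?_, ?_, ?_, hn, ?_, ?_, ?_, ?_⟩
  · intro v x
    constructor
    · rintro ⟨hx0, hx1⟩
      have : ∃ s, 0 ≤ s ∧ s ≤ Off ch l v (n v) ∧
          x = if sp v then l v - l v / Off ch l v (n v) * s else l v / Off ch l v (n v) * s := by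
        by_cases h : sp v = true
        · refine ⟨(l v - x) / (l v / Off ch l v (n v)), ?_, ?_, ?_⟩
          · exact div_nonneg (by linarith) (rpos v).le
          · rw [div_le_iff₀ (rpos v), mul_comm, rmul]; linarith
          · rw [if_pos h, mul_div_cancel₀ _ (rpos v).ne']; ring
        · refine ⟨x / (l v / Off ch l v (n v)), ?_, ?_, ?_⟩
          · exact div_nonneg hx0 (rpos v).le
          · rw [div_le_iff₀ (rpos v), mul_comm, rmul]; linarith
          · rw [if_neg h, mul_div_cancel₀ _ (rpos v).ne']
      obtain ⟨s, h0, h1, hx⟩ := this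
      obtain ⟨i, hi, h2, h3⟩ := Off_find v (n v) (hn v) s h0 h1
      refine ⟨i, hi, s - Off ch l v i, ⟨by linarith, by linarith⟩, ?_⟩
      rw [hx]; unfold gI; simp
    · rintro ⟨i, hi, t, ⟨ht0, ht1⟩, rfl⟩
      have h1 := Off_lt (ch := ch) hl v hi
      have h2 := Onn v i
      have h3 : l v / Off ch l v (n v) * (Off ch l v i + t) ≤ l v := by
        calc _ ≤ l v / Off ch l v (n v) * Off ch l v (n v) :=
              mul_le_mul_of_nonneg_left (by linarith) (rpos v).le
          _ = l v := rmul v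
      have h4 : 0 ≤ l v / Off ch l v (n v) * (Off ch l v i + t) :=
        mul_nonneg (rpos v).le (by linarith)
      unfold gI
      split_ifs
      · exact ⟨by linarith, by linarith⟩
      · exact ⟨h4, h3⟩
  · intro v i x y h
    have := geq _ _ _ _ _ h
    linarith
  · intro v e
    have := hl v
    cases e <;> simp [bI] <;> linarith
  · intro v i x y hi hx hy h
    have := geq _ _ _ _ _ h
    rw [Osucc] at this
    have h1 := hx.2
    have h2 := hy.1
    constructor
    · simp [bI]; linarith
    · simp [bI]; linarith
  · intro v i hi
    apply geq'
    rw [Osucc]; simp [bI]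
  · intro v i j x y hij hj hx hy h
    have := geq _ _ _ _ _ h
    have h1 := Off_lt (ch := ch) hl v (show i + 1 < j by omega)
    rw [Osucc] at h1
    have := hl (ch v (i+1))
    have h1 := hx.2
    have h2 := hy.1
    linarith
  · intro v e
    by_cases h : sp v = true
    · rw [h]
      cases e
      · simp [bI, gI, h, Olast, rmul]
      · simp [bI, gI, h, O0]
    · have h' : sp v = false := by simpa using h
      have h1 := hsp v h'
      have h2 := Olast v
      have h3 := rmul v
      rw [h1] at h2 h3
      simp only [Nat.sub_self] at h2
      rw [h']
      cases e
      · simp [bI, gI, h', O0, h1]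
      · simp [bI, gI, h', h1, h2, h3]
  · intro v e i x hi hx h
    by_cases hs : sp v = true
    · cases e
      · simp only [gI, hs, if_true, bI] at h
        have h2 : l v / Off ch l v (n v) * (Off ch l v i + x)
          = l v / Off ch l v (n v) * Off ch l v (n v) := by rw [rmul]; simp at h; linarith
        have h3 := mul_left_cancel₀ (rpos v).ne' h2
        by_contra hne
        simp at hne
        have h1 := Off_lt (ch := ch) hl v (show i + 1 < n v by omega)
        have := hl (ch v (i+1))
        rw [Osucc] at h1
        linarith [hx.2]
      · simp only [gI, hs, if_true, bI] at h
        have h2 : l v / Off ch l v (n v) * (Off ch l v i + x)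
          = l v / Off ch l v (n v) * 0 := by linarith
        have h3 := mul_left_cancel₀ (rpos v).ne' h2
        by_contra hne
        simp at hne
        have h1 := Off_lt (ch := ch) hl v (show 0 < i by omega)
        rw [O0] at h1
        have := hl (ch v 0)
        linarith [hx.1]
    · have := hsp v (by simpa using hs)
      split_ifs <;> omega
  · intro v x y hx hy
    have := hl8 v
    rw [abs_le]
    constructor <;> linarith [hx.1, hx.2, hy.1, hy.2]
  · intro k x y h
    rw [abs_sub_comm]; exact h
  · intro v i k x y h
    have h1 : |gI n ch sp l v i x - gI n ch sp l v i y| = l v / Off ch l v (n v) * |x - y| := by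
      unfold gI
      split_ifs
      · rw [show l v - l v / Off ch l v (n v) * (Off ch l v i + x) -
          (l v - l v / Off ch l v (n v) * (Off ch l v i + y))
          = - (l v / Off ch l v (n v) * (x - y)) by ring, abs_neg, abs_mul, abs_of_pos (rpos v)]
      · rw [show l v / Off ch l v (n v) * (Off ch l v i + x) -
          (l v / Off ch l v (n v) * (Off ch l v i + y))
          = (l v / Off ch l v (n v) * (x - y)) by ring, abs_mul, abs_of_pos (rpos v)]
    show |gI n ch sp l v i x - gI n ch sp l v i y| ≤ _
    rw [h1, pow_succ]
    calc _ ≤ 7/8 * (8 * (7/8 : ℝ)^k) := mul_le_mul (rle v) h (abs_nonneg _) (by norm_num)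
      _ = _ := by ring
  · intro x y h
    by_contra hne
    have hp : 0 < |x - y| := abs_pos.2 (sub_ne_zero.2 hne)
    obtain ⟨k, hk⟩ := exists_pow_lt_of_lt_one (show 0 < |x-y|/16 by positivity)
      (show (7/8:ℝ) < 1 by norm_num)
    obtain ⟨z, h1, h2⟩ := h k
    have := abs_sub_le x z y
    linarith

theorem gI_cont (v : ι) (i : ℕ) : Continuous (gI n ch sp l v i) := by
  unfold gI
  split_ifs <;> fun_prop

end Interval

/-! ### Arcs -/

def IsArc {E : Type*} [TopologicalSpace E] (S : Set E) (a b : E) : Prop :=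
  ∃ (L : ℝ) (γ : ℝ → E), 0 < L ∧ ContinuousOn γ (Set.Icc 0 L) ∧ Set.InjOn γ (Set.Icc 0 L) ∧
    γ '' Set.Icc 0 L = S ∧ γ 0 = a ∧ γ L = b

theorem sys_arc {ι E : Type*} [TopologicalSpace E] [T2Space E]
    {n : ι → ℕ} {ch : ι → ℕ → ι} {sp : ι → Bool} {l : ι → ℝ}
    {X : ι → Set E} {f : ι → ℕ → E → E} {a : ι → Bool → E} {D : ℕ → E → E → Prop}
    (hX : Sys n ch sp X f a D) (hXc : ∀ v, IsCompact (X v)) (hf : ∀ v i, Continuous (f v i))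
    (hsp : ∀ v, sp v = false → n v = 1)
    (hl : ∀ v, 0 < l v) (hl8 : ∀ v, l v ≤ 8)
    (hc : ∀ v, l v ≤ 7/8 * Off ch l v (n v)) (v : ι) : IsArc (X v) (a v false) (a v true) := by
  obtain ⟨γ, h1, h2, h3, h4⟩ := abstract_homeo hX
    (interval_sys hX.npos hsp hl hl8 hc) hXc (fun v => isCompact_Icc) hf gI_cont v
  exact ⟨l v, γ, hl v, h1, h2, h3, by simpa [bI] using h4 false, by simpa [bI] using h4 true⟩


/-! ### Gluing arcs -/

section Glue
variable {E : Type*} [TopologicalSpace E]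

noncomputable def glue (L : ℝ) (γ₁ γ₂ : ℝ → E) (t : ℝ) : E := if t ≤ L then γ₁ t else γ₂ (t - L)

theorem glue_left {L : ℝ} {γ₁ γ₂ : ℝ → E} {t : ℝ} (h : t ≤ L) : glue L γ₁ γ₂ t = γ₁ t := if_pos h

theorem glue_right {L : ℝ} {γ₁ γ₂ : ℝ → E} {t : ℝ} (h : L ≤ t) (hg : γ₁ L = γ₂ 0) :
    glue L γ₁ γ₂ t = γ₂ (t - L) := by
  rcases h.eq_or_lt with rfl | h
  · simp [glue, hg]
  · exact if_neg (not_le.2 h)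

theorem glue_cont {L L' : ℝ} {γ₁ γ₂ : ℝ → E} (hL : 0 < L) (hL' : 0 < L')
    (h1 : ContinuousOn γ₁ (Set.Icc 0 L)) (h2 : ContinuousOn γ₂ (Set.Icc 0 L'))
    (hg : γ₁ L = γ₂ 0) : ContinuousOn (glue L γ₁ γ₂) (Set.Icc 0 (L + L')) := by
  have : Set.Icc 0 (L + L') = Set.Icc 0 L ∪ Set.Icc L (L + L') :=
    (Set.Icc_union_Icc_eq_Icc hL.le (by linarith)).symm
  rw [this]
  refine ContinuousOn.union_of_isClosed ?_ ?_ isClosed_Icc isClosed_Icc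
  · exact h1.congr fun t ht => glue_left ht.2
  · have : ContinuousOn (fun t => γ₂ (t - L)) (Set.Icc L (L + L')) :=
      h2.comp (by fun_prop) (fun t ht => ⟨by linarith [ht.1], by linarith [ht.2]⟩)
    exact this.congr fun t ht => glue_right ht.1 hg

theorem glue_image {L L' : ℝ} {γ₁ γ₂ : ℝ → E} (hL : 0 < L) (hL' : 0 < L')
    (hg : γ₁ L = γ₂ 0) : glue L γ₁ γ₂ '' (Set.Icc 0 (L + L')) =
      γ₁ '' Set.Icc 0 L ∪ γ₂ '' Set.Icc 0 L' := by
  ext x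
  constructor
  · rintro ⟨t, ht, rfl⟩
    rcases le_total t L with h | h
    · rw [glue_left h]; exact Or.inl ⟨t, ⟨ht.1, h⟩, rfl⟩
    · rw [glue_right h hg]; exact Or.inr ⟨t - L, ⟨by linarith, by linarith [ht.2]⟩, rfl⟩
  · rintro (⟨t, ht, rfl⟩ | ⟨t, ht, rfl⟩)
    · exact ⟨t, ⟨ht.1, by linarith [ht.2]⟩, glue_left ht.2⟩
    · refine ⟨t + L, ⟨by linarith [ht.1], by linarith [ht.2]⟩, ?_⟩
      rw [glue_right (by linarith [ht.1]) hg]; simp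

theorem IsArc.concat {S S' : Set E} {a b c : E} (h : IsArc S a b) (h' : IsArc S' b c)
    (hi : ∀ x, x ∈ S → x ∈ S' → x = b) : IsArc (S ∪ S') a c := by
  obtain ⟨L, γ₁, hL, c1, i1, rfl, rfl, hb⟩ := h
  obtain ⟨L', γ₂, hL', c2, i2, rfl, hb', rfl⟩ := h'
  have hg : γ₁ L = γ₂ 0 := hb.trans hb'.symm
  have key : ∀ s t, 0 ≤ s → s ≤ L → L < t → t ≤ L + L' → γ₁ s ≠ γ₂ (t - L) := by
    intro s t h0 h1 h2 h3 he
    have m1 : γ₁ s ∈ γ₁ '' Set.Icc 0 L := ⟨s, ⟨h0, h1⟩, rfl⟩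
    have m2 : γ₁ s ∈ γ₂ '' Set.Icc 0 L' := ⟨t - L, ⟨by linarith, by linarith⟩, he.symm⟩
    have := hi _ m1 m2
    rw [he, ← hb'] at this
    have := i2 ⟨by linarith, by linarith⟩ ⟨le_rfl, hL'.le⟩ this
    linarith
  refine ⟨L + L', glue L γ₁ γ₂, by linarith, glue_cont hL hL' c1 c2 hg, ?_,
    glue_image hL hL' hg, glue_left hL.le, ?_⟩
  · intro s hs t ht he
    rcases le_or_gt s L with h | h <;> rcases le_or_gt t L with h2 | h2
    · rw [glue_left h, glue_left h2] at he
      exact i1 ⟨hs.1, h⟩ ⟨ht.1, h2⟩ he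
    · rw [glue_left h, glue_right h2.le hg] at he
      exact absurd he (key s t hs.1 h h2 ht.2)
    · rw [glue_left h2, glue_right h.le hg] at he
      exact absurd he.symm (key t s ht.1 h2 h hs.2)
    · rw [glue_right h.le hg, glue_right h2.le hg] at he
      have := i2 ⟨by linarith, by linarith [hs.2]⟩ ⟨by linarith, by linarith [ht.2]⟩ he
      linarith
  · rw [glue_right (by linarith) hg]; simp

theorem IsArc.symm {S : Set E} {a b : E} (h : IsArc S a b) : IsArc S b a := by
  obtain ⟨L, γ, hL, c, i, rfl, rfl, rfl⟩ := h
  refine ⟨L, fun t => γ (L - t), hL, ?_, ?_, ?_, by simp, by simp⟩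
  · exact c.comp (by fun_prop) (fun t ht => ⟨by linarith [ht.2], by linarith [ht.1]⟩)
  · intro s hs t ht he
    have := i ⟨by linarith [hs.2], by linarith [hs.1]⟩ ⟨by linarith [ht.2], by linarith [ht.1]⟩ he
    linarith
  · ext x
    constructor
    · rintro ⟨t, ht, rfl⟩; exact ⟨L - t, ⟨by linarith [ht.2], by linarith [ht.1]⟩, rfl⟩
    · rintro ⟨t, ht, rfl⟩
      exact ⟨L - t, ⟨by linarith [ht.2], by linarith [ht.1]⟩, by simp⟩

theorem IsArc.closed [T2Space E] {S S' : Set E} {a b : E} (h : IsArc S a b) (h' : IsArc S' b a)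
    (hi : ∀ x, x ∈ S → x ∈ S' → x = a ∨ x = b) :
    Nonempty ((S ∪ S' : Set E) ≃ₜ Metric.sphere (0 : EuclideanSpace ℝ (Fin 2)) 1) := by
  obtain ⟨L, γ₁, hL, c1, i1, rfl, ha, hb⟩ := h
  obtain ⟨L', γ₂, hL', c2, i2, rfl, hb', ha'⟩ := h'
  have hg : γ₁ L = γ₂ 0 := hb.trans hb'.symm
  have key : ∀ s t, 0 ≤ s → s ≤ L → L < t → t < L + L' → γ₁ s ≠ γ₂ (t - L) := by
    intro s t h0 h1 h2 h3 he
    have m1 : γ₁ s ∈ γ₁ '' Set.Icc 0 L := ⟨s, ⟨h0, h1⟩, rfl⟩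
    have m2 : γ₁ s ∈ γ₂ '' Set.Icc 0 L' := ⟨t - L, ⟨by linarith, by linarith⟩, he.symm⟩
    rcases hi _ m1 m2 with h | h
    · rw [he, ← ha'] at h
      have := i2 ⟨by linarith, by linarith⟩ ⟨hL'.le, le_rfl⟩ h
      linarith
    · rw [he, ← hb'] at h
      have := i2 ⟨by linarith, by linarith⟩ ⟨le_rfl, hL'.le⟩ h
      linarith
  set P := L + L' with hP
  set γ := glue L γ₁ γ₂ with hγ
  have hPp : 0 < P := by linarith
  have hcont : ContinuousOn γ (Set.Icc 0 P) := glue_cont hL hL' c1 c2 hg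
  have himg : γ '' (Set.Icc 0 P) = _ := glue_image hL hL' hg
  have hclos : γ 0 = γ P := by
    rw [hγ, glue_left hL.le, glue_right (by linarith) hg, ha, hP]; simp [ha']
  have hinj : Set.InjOn γ (Set.Ico 0 P) := by
    intro s hs t ht he
    rcases le_or_gt s L with h | h <;> rcases le_or_gt t L with h2 | h2
    · rw [hγ, glue_left h, glue_left h2] at he
      exact i1 ⟨hs.1, h⟩ ⟨ht.1, h2⟩ he
    · rw [hγ, glue_left h, glue_right h2.le hg] at he
      exact absurd he (key s t hs.1 h h2 ht.2)
    · rw [hγ, glue_left h2, glue_right h.le hg] at he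
      exact absurd he.symm (key t s ht.1 h2 h hs.2)
    · rw [hγ, glue_right h.le hg, glue_right h2.le hg] at he
      have := i2 ⟨by linarith, by linarith [hs.2]⟩ ⟨by linarith, by linarith [ht.2]⟩ he
      linarith
  rw [← himg]
  haveI : Fact (0 < P) := ⟨hPp⟩
  have lc : Continuous (AddCircle.liftIco P 0 γ) :=
    AddCircle.liftIco_continuous (by simpa using hclos) (by simpa using hcont)
  have rep : ∀ z : AddCircle P, ∃ t ∈ Set.Ico (0:ℝ) P, (t : AddCircle P) = z := by
    intro z
    have := AddCircle.coe_image_Ico_eq P 0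
    have hz : z ∈ (QuotientAddGroup.mk '' Set.Ico (0:ℝ) (0 + P) : Set (AddCircle P)) := by
      rw [this]; trivial
    simpa using hz
  have lval : ∀ t ∈ Set.Ico (0:ℝ) P, AddCircle.liftIco P 0 γ (t : AddCircle P) = γ t := by
    intro t ht
    exact AddCircle.liftIco_coe_apply (by simpa using ht)
  let F : AddCircle P → γ '' (Set.Icc 0 P) := fun z => ⟨AddCircle.liftIco P 0 γ z, by
    obtain ⟨t, ht, rfl⟩ := rep z
    rw [lval t ht]
    exact ⟨t, ⟨ht.1, ht.2.le⟩, rfl⟩⟩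
  have Fc : Continuous F := lc.subtype_mk _
  have Fb : Function.Bijective F := by
    constructor
    · intro z z' h
      obtain ⟨t, ht, rfl⟩ := rep z
      obtain ⟨t', ht', rfl⟩ := rep z'
      have h2 : AddCircle.liftIco P 0 γ (t : AddCircle P) =
        AddCircle.liftIco P 0 γ (t' : AddCircle P) := congrArg Subtype.val h
      rw [lval t ht, lval t' ht'] at h2
      rw [hinj ht ht' h2]
    · rintro ⟨x, t, ht, rfl⟩
      rcases ht.2.eq_or_lt with h | h
      · refine ⟨((0:ℝ) : AddCircle P), Subtype.ext ?_⟩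
        show AddCircle.liftIco P 0 γ ((0:ℝ) : AddCircle P) = γ t
        rw [lval 0 ⟨le_rfl, hPp⟩, hclos, h]
      · exact ⟨(t : AddCircle P), Subtype.ext (lval t ⟨ht.1, h⟩)⟩
  have e1 : AddCircle P ≃ₜ γ '' (Set.Icc 0 P) :=
    Continuous.homeoOfEquivCompactToT2 (f := Equiv.ofBijective F Fb) Fc
  have e2 : AddCircle P ≃ₜ Circle := AddCircle.homeomorphCircle hPp.ne'
  let I := Complex.orthonormalBasisOneI.repr
  have e3 : Circle ≃ₜ Metric.sphere (0 : EuclideanSpace ℝ (Fin 2)) 1 :=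
    { toFun := fun z => ⟨I (z : ℂ), by simp [Circle.norm_coe]⟩
      invFun := fun w => ⟨I.symm w, by simp [Submonoid.unitSphere]⟩
      left_inv := fun z => by ext; simp
      right_inv := fun w => by ext; simp
      continuous_toFun := by fun_prop
      continuous_invFun := by fun_prop }
  exact ⟨e1.symm.trans (e2.trans e3)⟩

end Glue


/-! ## The tile: basic facts -/

section Tile

noncomputable def Mf (A B C : ℤ) (x : Fin 3 → ℝ) : Fin 3 → ℝ :=
  ![-(C:ℝ) * x 2, x 0 - B * x 2, x 1 - A * x 2]

noncomputable def Mi (A B C : ℤ) (x : Fin 3 → ℝ) : Fin 3 → ℝ :=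
  ![x 1 - B * (x 0 / C), x 2 - A * (x 0 / C), - (x 0 / C)]

theorem Mmat_eq (A B C : ℤ) (x : Fin 3 → ℝ) : (Mmat A B C).mulVec x = Mf A B C x := by
  funext i
  fin_cases i <;> simp [Mmat, Mf, Matrix.mulVec, dotProduct, Fin.sum_univ_three] <;> ring

theorem Mf_Mi {A B C : ℤ} (hC : C ≠ 0) (x : Fin 3 → ℝ) : Mf A B C (Mi A B C x) = x := by
  have : (C : ℝ) ≠ 0 := by exact_mod_cast hC
  funext i
  fin_cases i <;> simp [Mf, Mi] <;> field_simp

theorem Mi_Mf {A B C : ℤ} (hC : C ≠ 0) (x : Fin 3 → ℝ) : Mi A B C (Mf A B C x) = x := by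
  have : (C : ℝ) ≠ 0 := by exact_mod_cast hC
  funext i
  fin_cases i <;> simp [Mf, Mi] <;> field_simp <;> ring

theorem Mf_sub (A B C : ℤ) (x y : Fin 3 → ℝ) : Mf A B C (x - y) = Mf A B C x - Mf A B C y := by
  funext i
  fin_cases i <;> simp [Mf] <;> ring

theorem Mf_iter_sub (A B C : ℤ) (n : ℕ) : ∀ (x y : Fin 3 → ℝ),
    (Mf A B C)^[n] (x - y) = (Mf A B C)^[n] x - (Mf A B C)^[n] y := by
  induction n with
  | zero => intro x y; rfl
  | succ n ih => intro x y; rw [Function.iterate_succ_apply, Mf_sub, ih]; rfl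

theorem Mf_cont (A B C : ℤ) : Continuous (Mf A B C) := by
  refine continuous_pi fun i => ?_
  fin_cases i <;> simp [Mf] <;> fun_prop

theorem Mi_cont (A B C : ℤ) : Continuous (Mi A B C) := by
  refine continuous_pi fun i => ?_
  fin_cases i <;> simp [Mi] <;> fun_prop

theorem rec_key {A B C : ℝ} (hA : 1 ≤ A) (hB : A ≤ B) (hC : B + 1 ≤ C) {c : ℕ → ℝ}
    (hr : ∀ n, c (n+3) + A * c (n+2) + B * c (n+1) + C * c n = 0) {s : ℝ} (hs : 0 ≤ s)
    (hb : ∀ n, c n ≤ s) {δ : ℝ} (hδ : 0 ≤ δ) (n : ℕ) (h : (1 - δ) * s ≤ c n) :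
    (1 - C * δ) * s ≤ c (n+1) := by
  have e : C * c n = (C - B) * c (n+1) + (B - A) * c (n+2) + (A - 1) * c (n+3) + c (n+4) := by
    have h1 := hr n
    have h2 := hr (n+1)
    rw [show n + 1 + 3 = n + 4 by ring, show n + 1 + 2 = n + 3 by ring,
      show n + 1 + 1 = n + 2 by ring] at h2
    linarith
  have h2 : (B - A) * c (n+2) ≤ (B - A) * s := mul_le_mul_of_nonneg_left (hb _) (by linarith)
  have h3 : (A - 1) * c (n+3) ≤ (A - 1) * s := mul_le_mul_of_nonneg_left (hb _) (by linarith)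
  have h4 := hb (n+4)
  have h5 : C * ((1 - δ) * s) ≤ C * c n := mul_le_mul_of_nonneg_left h (by linarith)
  have h6 : (C - B) * (s - c (n+1)) ≤ C * δ * s := by nlinarith
  have h7 : (s - c (n+1)) ≤ (C - B) * (s - c (n+1)) := by
    have := hb (n+1)
    nlinarith
  nlinarith

theorem rec_key2 {A B C : ℝ} (hA : 1 ≤ A) (hB : A ≤ B) (hC : B + 1 ≤ C) {c : ℕ → ℝ}
    (hr : ∀ n, c (n+3) + A * c (n+2) + B * c (n+1) + C * c n = 0) {s : ℝ} (hs : 0 ≤ s)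
    (hb : ∀ n, c n ≤ s) (n : ℕ) : c n ≤ (1 - 1 / (2 * C^3)) * s := by
  have hC0 : 2 ≤ C := by linarith
  rcases hs.eq_or_lt with rfl | hs'
  · simpa using hb n
  by_contra hcon
  push Not at hcon
  set δ := 1 / (2 * C^3) with hδ
  have hδ0 : 0 < δ := by positivity
  have k1 := rec_key hA hB hC hr hs hb hδ0.le n hcon.le
  have k2 := rec_key hA hB hC hr hs hb (by positivity) (n+1) k1
  have k3 := rec_key hA hB hC hr hs hb (by positivity) (n+2) k2
  have e3 : C * (C * (C * δ)) = 1/2 := by rw [hδ]; field_simp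
  have e2 : C * (C * δ) ≤ 1/2 := by
    have : 0 < C * (C * δ) := by positivity
    nlinarith
  have e1 : C * δ ≤ 1/2 := by
    have : 0 < C * δ := by positivity
    nlinarith
  have e0 : δ ≤ 1/2 := by nlinarith
  have p0 : 0 < c n := lt_of_le_of_lt (by nlinarith) hcon
  have p1 : 0 < c (n+1) := lt_of_lt_of_le (by nlinarith) k1
  have p2 : 0 < c (n+2) := lt_of_lt_of_le (by nlinarith) k2
  have p3 : 0 < c (n+3) := lt_of_lt_of_le (by nlinarith) k3
  have := hr n
  have q1 : 0 < A * c (n+2) := mul_pos (by linarith) p2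
  have q2 : 0 < B * c (n+1) := mul_pos (by linarith) p1
  have q3 : 0 < C * c n := mul_pos (by linarith) p0
  linarith

theorem rec_zero {A B C : ℝ} (hA : 1 ≤ A) (hB : A ≤ B) (hC : B + 1 ≤ C) {c : ℕ → ℝ}
    (hr : ∀ n, c (n+3) + A * c (n+2) + B * c (n+1) + C * c n = 0) {s : ℝ}
    (hb : ∀ n, |c n| ≤ s) (n : ℕ) : c n = 0 := by
  have hs : 0 ≤ s := (abs_nonneg _).trans (hb 0)
  have hC0 : 2 ≤ C := by linarith
  set ρ := 1 - 1 / (2 * C^3) with hρ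
  have hρ1 : ρ < 1 := by have : 0 < 1 / (2 * C^3) := by positivity
                         linarith
  have hρ0 : 0 ≤ ρ := by
    have : 1 / (2 * C^3) ≤ 1 := by
      rw [div_le_one (by positivity)]
      have : (1:ℝ) ≤ C^3 := one_le_pow₀ (by linarith)
      linarith
    linarith
  have key : ∀ k : ℕ, ∀ n, |c n| ≤ ρ ^ k * s := by
    intro k
    induction k with
    | zero => simpa using hb
    | succ k ih =>
      intro n
      have hk : 0 ≤ ρ ^ k * s := by positivity
      have h1 := rec_key2 hA hB hC hr hk (fun n => (abs_le.1 (ih n)).2) n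
      have h2 := rec_key2 (c := fun n => - c n) hA hB hC (fun n => by linarith [hr n]) hk
        (fun n => by linarith [(abs_le.1 (ih n)).1]) n
      rw [abs_le, pow_succ]
      constructor <;> nlinarith
  have lim : Filter.Tendsto (fun k : ℕ => ρ ^ k * s) Filter.atTop (nhds 0) := by
    simpa using (tendsto_pow_atTop_nhds_zero_of_lt_one hρ0 hρ1).mul_const s
  have := ge_of_tendsto' lim (fun k => key k n)
  exact abs_eq_zero.1 (le_antisymm this (abs_nonneg _))

theorem Mf_exp {A B C : ℤ} (hA : 1 ≤ A) (hB : A ≤ B) (hC : B < C) {x y : Fin 3 → ℝ} {K : ℝ}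
    (h : ∀ n, ‖(Mf A B C)^[n] x - (Mf A B C)^[n] y‖ ≤ K) : x = y := by
  set u := x - y with hu
  have hb : ∀ n, ‖(Mf A B C)^[n] u‖ ≤ K := fun n => by rw [hu, Mf_iter_sub]; exact h n
  have hc : ∀ n, ((Mf A B C)^[n] u) 2 = 0 := by
    intro n
    refine rec_zero (A := A) (B := B) (C := C) (c := fun n => ((Mf A B C)^[n] u) 2) (s := K)
      (by exact_mod_cast hA) (by exact_mod_cast hB) (by exact_mod_cast hC) ?_ ?_ n
    · intro n
      simp only [Function.iterate_succ_apply']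
      simp [Mf]
    · intro n
      exact (norm_le_pi_norm ((Mf A B C)^[n] u) 2).trans (hb n)
  have h0 := hc 0
  have h1 := hc 1
  have h2 := hc 2
  simp [Mf] at h0 h1 h2
  rw [h0] at h1 h2
  simp at h1 h2
  rw [h1] at h2
  simp at h2
  rw [← sub_eq_zero, ← hu]
  funext i
  fin_cases i <;> simp [h0, h1, h2]

def vz (A B : ℤ) (p : Fin 4 → ℤ) : Fin 3 → ℤ :=
  ![(p 3 - p 2) + A * (p 2 - p 1) + B * (p 1 - p 0), (p 2 - p 1) + A * (p 1 - p 0), p 1 - p 0]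

theorem toR_vz (A B : ℤ) (p : Fin 4 → ℤ) : toR (vz A B p) =
    ![((p 3 : ℝ) - p 2) + A * (p 2 - p 1) + B * (p 1 - p 0), (p 2 - p 1) + A * (p 1 - p 0),
      (p 1 : ℝ) - p 0] := by
  funext i
  fin_cases i <;> simp [vz, toR]

theorem vz_sub (A B : ℤ) (p q : Fin 4 → ℤ) : vz A B (p - q) = vz A B p - vz A B q := by
  funext i
  fin_cases i <;> simp [vz] <;> ring

theorem toR_sub (p q : Fin 3 → ℤ) : toR (p - q) = toR p - toR q := by
  funext i; simp [toR]

def In (T : Set (Fin 3 → ℝ)) (A B : ℤ) (x : Fin 3 → ℝ) (p : Fin 4 → ℤ) : Prop :=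
  x - toR (vz A B p) ∈ T

def GStep (A B C : ℤ) (p q : Fin 4 → ℤ) : Prop :=
  q 0 = p 1 ∧ q 1 = p 2 ∧ q 2 = p 3 ∧
  C * p 0 ≤ (C - B) * p 1 + (B - A) * p 2 + (A - 1) * p 3 + q 3 ∧
  (C - B) * p 1 + (B - A) * p 2 + (A - 1) * p 3 + q 3 < C * p 0 + C

variable {A B C : ℤ} {T : Set (Fin 3 → ℝ)}

theorem In_ext {x : Fin 3 → ℝ} {p q : Fin 4 → ℤ} (h : In T A B x p)
    (h0 : p 0 = q 0) (h1 : p 1 = q 1) (h2 : p 2 = q 2) (h3 : p 3 = q 3) : In T A B x q := by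
  have : p = q := by funext i; fin_cases i <;> assumption
  rwa [← this]

theorem In_const {x : Fin 3 → ℝ} {p q : Fin 4 → ℤ} (h : In T A B x p) (c : ℤ)
    (hc : ∀ l, q l = p l + c) : In T A B x q := by
  have : vz A B q = vz A B p := by
    funext i; fin_cases i <;> simp [vz, hc]
  unfold In at *
  rwa [this]

theorem In_step (hT : IsABCTile A B C T) {x : Fin 3 → ℝ} {p q : Fin 4 → ℤ} (h : GStep A B C p q)
    (hx : In T A B (Mf A B C x) q) : In T A B x p := by
  obtain ⟨hA, hB, hC, -, -, -, hM⟩ := hT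
  obtain ⟨h0, h1, h2, h3, h4⟩ := h
  have : Mf A B C (x - toR (vz A B p)) ∈ ⋃ d ∈ Ddig C, tileTranslate d T := by
    simp only [Set.mem_iUnion]
    refine ⟨![(((C - B) * p 1 + (B - A) * p 2 + (A - 1) * p 3 + q 3 - C * p 0 : ℤ) : ℝ), 0, 0],
      ⟨_, by linarith, by linarith, rfl⟩, ?_⟩
    refine ⟨_, hx, ?_⟩
    rw [Mf_sub]
    funext i
    fin_cases i <;> simp [Mf, toR_vz, h0, h1, h2] <;> ring
  rw [← hM] at this
  obtain ⟨y, hy, e⟩ := this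
  rw [Mmat_eq] at e
  have e2 := congrArg (Mi A B C) e
  rw [Mi_Mf (by omega), Mi_Mf (by omega)] at e2
  unfold In
  rwa [← e2]

theorem In_next (hT : IsABCTile A B C T) {x : Fin 3 → ℝ} {p : Fin 4 → ℤ} (hx : In T A B x p) :
    ∃ s, GStep A B C p ![p 1, p 2, p 3, s] ∧ In T A B (Mf A B C x) ![p 1, p 2, p 3, s] := by
  obtain ⟨hA, hB, hC, -, -, -, hM⟩ := hT
  have : Mf A B C (x - toR (vz A B p)) ∈ ⋃ d ∈ Ddig C, tileTranslate d T := by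
    rw [← hM]; exact ⟨_, hx, Mmat_eq _ _ _ _⟩
  simp only [Set.mem_iUnion] at this
  obtain ⟨d, ⟨i, hi0, hi1, rfl⟩, y, hy, e⟩ := this
  refine ⟨i + C * p 0 - ((C - B) * p 1 + (B - A) * p 2 + (A - 1) * p 3), ?_, ?_⟩
  · simp only [GStep]
    simp
    constructor <;> linarith
  · unfold In
    convert hy using 1
    rw [Mf_sub] at e
    simp only at e
    rw [eq_sub_iff_add_eq] at e
    rw [← e]
    funext i
    fin_cases i <;> simp [Mf, toR_vz, Matrix.vecHead, Matrix.vecTail] <;> ring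

theorem In_bound (hT : IsABCTile A B C T) : ∃ K, ∀ x y p, In T A B x p → In T A B y p → ‖x - y‖ ≤ K := by
  obtain ⟨-, -, -, -, hc, -⟩ := hT
  obtain ⟨K, hK⟩ := hc.isBounded.exists_norm_le
  refine ⟨K + K, fun x y p hx hy => ?_⟩
  have : x - y = (x - toR (vz A B p)) - (y - toR (vz A B p)) := by abel
  rw [this]
  exact (norm_sub_le _ _).trans (add_le_add (hK _ hx) (hK _ hy))

theorem In_isClosed (hT : IsABCTile A B C T) (p : Fin 4 → ℤ) : IsClosed {x | In T A B x p} :=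
  hT.2.2.2.2.1.isClosed.preimage (continuous_id.sub continuous_const)

theorem In_isCompact (hT : IsABCTile A B C T) (p : Fin 4 → ℤ) : IsCompact {x | In T A B x p} := by
  have := hT.2.2.2.2.1.image (f := fun x => x + toR (vz A B p)) (by fun_prop)
  convert this using 1
  ext x
  simp only [Set.mem_ofPred_eq, Set.mem_image, In]
  constructor
  · intro h; exact ⟨_, h, by abel⟩
  · rintro ⟨y, hy, rfl⟩; simpa using hy

theorem path_point (hT : IsABCTile A B C T) (P : ℕ → Fin 4 → ℤ)
    (hP : ∀ n, GStep A B C (P n) (P (n+1))) :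
    ∃ z, ∀ m, In T A B ((Mf A B C)^[m] z) (P m) := by
  have hC : C ≠ 0 := by have := hT.1; have := hT.2.1; have := hT.2.2.1; omega
  have back : ∀ n y, In T A B y (P n) →
      ∃ z, (Mf A B C)^[n] z = y ∧ ∀ m ≤ n, In T A B ((Mf A B C)^[m] z) (P m) := by
    intro n
    induction n with
    | zero => intro y hy; exact ⟨y, rfl, fun m hm => by obtain rfl : m = 0 := by omega
                                                        exact hy⟩
    | succ n ih =>
      intro y hy
      have h1 : In T A B (Mi A B C y) (P n) := In_step hT (hP n) (by rwa [Mf_Mi hC])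
      obtain ⟨z, hz, hz2⟩ := ih _ h1
      have h3 : (Mf A B C)^[n+1] z = y := by rw [Function.iterate_succ_apply', hz, Mf_Mi hC]
      refine ⟨z, h3, fun m hm => ?_⟩
      rcases Nat.lt_or_ge n m with h | h
      · obtain rfl : m = n + 1 := by omega
        rwa [h3]
      · exact hz2 m h
  have clos : ∀ n, IsClosed {z | ∀ m ≤ n, In T A B ((Mf A B C)^[m] z) (P m)} := by
    intro n
    simp only [Set.ofPred_forall]
    refine isClosed_iInter fun m => isClosed_iInter fun _ => ?_
    exact (In_isClosed hT (P m)).preimage ((Mf_cont A B C).iterate m)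
  obtain ⟨z, hz⟩ := IsCompact.nonempty_iInter_of_sequence_nonempty_isCompact_isClosed
    (fun n => {z | ∀ m ≤ n, In T A B ((Mf A B C)^[m] z) (P m)})
    (fun n z hz m hm => hz m (by omega))
    (fun n => by
      obtain ⟨t, ht⟩ := hT.2.2.2.1
      obtain ⟨z, -, hz⟩ := back n (t + toR (vz A B (P n))) (by simpa [In] using ht)
      exact ⟨z, hz⟩)
    ((In_isCompact hT (P 0)).of_isClosed_subset (clos 0) (fun z hz => hz 0 le_rfl))
    clos
  rw [Set.mem_iInter] at hz
  exact ⟨z, fun m => hz m m le_rfl⟩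

theorem vz_bound (A B : ℤ) (N : ℤ) : ∃ K : ℝ, ∀ p q : Fin 4 → ℤ, (∀ l, |p l - q l| ≤ N) →
    ‖toR (vz A B p) - toR (vz A B q)‖ ≤ K := by
  refine ⟨((N + N) + |A| * (N + N) + |B| * (N + N) : ℤ), fun p q h => ?_⟩
  have hN : 0 ≤ N := (abs_nonneg _).trans (h 0)
  rw [← toR_sub, ← vz_sub]
  have hd : ∀ l m, |(p - q) l - (p - q) m| ≤ N + N := fun l m => by
    have := h l; have := h m
    simp only [Pi.sub_apply]
    rw [abs_le] at *
    omega
  generalize p - q = r at hd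
  rw [pi_norm_le_iff_of_nonneg (by positivity)]
  have a1 : |A * (r 2 - r 1)| ≤ |A| * (N + N) := by
    rw [abs_mul]; exact mul_le_mul_of_nonneg_left (hd 2 1) (abs_nonneg _)
  have a2 : |A * (r 1 - r 0)| ≤ |A| * (N + N) := by
    rw [abs_mul]; exact mul_le_mul_of_nonneg_left (hd 1 0) (abs_nonneg _)
  have a3 : |B * (r 1 - r 0)| ≤ |B| * (N + N) := by
    rw [abs_mul]; exact mul_le_mul_of_nonneg_left (hd 1 0) (abs_nonneg _)
  have b1 : 0 ≤ |A| * (N + N) := by positivity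
  have b2 : 0 ≤ |B| * (N + N) := by positivity
  have c1 := hd 3 2
  have c2 := hd 2 1
  have c3 := hd 1 0
  have main : ∀ i, |vz A B r i| ≤ (N + N) + |A| * (N + N) + |B| * (N + N) := by
    intro i
    rw [abs_le] at *
    fin_cases i <;> simp [vz] <;> constructor <;> linarith
  intro i
  simp only [toR, Real.norm_eq_abs]
  exact_mod_cast main i

theorem paths_point (hT : IsABCTile A B C T) {J : Type*} (j0 : J) (P : J → ℕ → Fin 4 → ℤ)
    (hP : ∀ j n, GStep A B C (P j n) (P j (n+1))) (N : J → ℤ)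
    (hN : ∀ j n l, |P j n l - P j0 n l| ≤ N j) :
    ∃ z, ∀ j, In T A B z (P j 0) := by
  choose z hz using fun j => path_point hT (P j) (hP j)
  obtain ⟨K, hK⟩ := In_bound hT
  refine ⟨z j0, fun j => ?_⟩
  obtain ⟨K', hK'⟩ := vz_bound A B (N j)
  have : z j = z j0 := by
    refine Mf_exp (K := K + K') hT.1 hT.2.1 hT.2.2.1 fun n => ?_
    have h1 : In T A B ((Mf A B C)^[n] (z j) - (toR (vz A B (P j n)) - toR (vz A B (P j0 n))))
        (P j0 n) := by
      have := hz j n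
      unfold In at *
      convert this using 1
      abel
    have h2 := hK _ _ _ h1 (hz j0 n)
    have h3 := hK' _ _ (hN j n)
    have e : (Mf A B C)^[n] (z j) - (Mf A B C)^[n] (z j0) =
      ((Mf A B C)^[n] (z j) - (toR (vz A B (P j n)) - toR (vz A B (P j0 n))) - (Mf A B C)^[n] (z j0))
        + (toR (vz A B (P j n)) - toR (vz A B (P j0 n))) := by abel
    rw [e]
    exact (norm_add_le _ _).trans (add_le_add h2 h3)
  rw [← this]
  exact hz j 0

end Tile


section Nbr

def EE (T : Set (Fin 3 → ℝ)) (A B : ℤ) (m : ℤ) (k : Fin 4 → ℤ) : Set (Fin 3 → ℝ) :=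
  {x | ∀ t : ℤ, In T A B x (fun l => (k l + t) / m)}

def nx (A B C : ℤ) (k : Fin 4 → ℤ) : Fin 4 → ℤ :=
  ![k 1, k 2, k 3, k 0 - 4 * ((C - B) * ((k 1 - k 0) / 4) + (B - A) * ((k 2 - k 0) / 4) +
    (A - 1) * ((k 3 - k 0) / 4))]

variable {A B C : ℤ} {T : Set (Fin 3 → ℝ)}

theorem nx_0 (k : Fin 4 → ℤ) : nx A B C k 0 = k 1 := rfl
theorem nx_1 (k : Fin 4 → ℤ) : nx A B C k 1 = k 2 := rfl
theorem nx_2 (k : Fin 4 → ℤ) : nx A B C k 2 = k 3 := rfl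
theorem nx_3 (k : Fin 4 → ℤ) : nx A B C k 3 = k 0 - 4 * ((C - B) * ((k 1 - k 0) / 4) +
    (B - A) * ((k 2 - k 0) / 4) + (A - 1) * ((k 3 - k 0) / 4)) := rfl

theorem fl4 (k u t : ℤ) : (k + t) / 4 = (u + t) / 4 + (k - u) / 4 ∨
    (k + t) / 4 = (u + t) / 4 + (k - u) / 4 + 1 := by omega

theorem gstep4 (hA : 1 ≤ A) (hB : A ≤ B) (hC : B < C) (k : Fin 4 → ℤ) (t : ℤ) :
    GStep A B C (fun l => (k l + t) / 4) (fun l => (nx A B C k l + t) / 4) := by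
  refine ⟨rfl, rfl, rfl, ?_⟩
  simp only [nx_3]
  have e : ∀ κ : ℤ, (k 0 - 4 * κ + t) / 4 = (k 0 + t) / 4 - κ := by intro κ; omega
  rw [e]
  rcases fl4 (k 1) (k 0) t with h1 | h1 <;> rcases fl4 (k 2) (k 0) t with h2 | h2 <;>
  rcases fl4 (k 3) (k 0) t with h3 | h3 <;> rw [h1, h2, h3] <;> constructor <;> linarith

theorem EE4_nonempty (hT : IsABCTile A B C T) (k : Fin 4 → ℤ) : (EE T A B 4 k).Nonempty := by
  obtain ⟨z, hz⟩ := paths_point hT (J := ℤ) 0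
    (fun t n l => (((nx A B C)^[n] k) l + t) / 4)
    (fun t n => by
      have := gstep4 hT.1 hT.2.1 hT.2.2.1 ((nx A B C)^[n] k) t
      simpa only [Function.iterate_succ_apply'] using this)
    (fun t => |t| + 1)
    (fun t n l => by
      generalize ((nx A B C)^[n] k) l = a
      rw [abs_le]
      rcases abs_cases t with ⟨h, _⟩ | ⟨h, _⟩ <;> rw [h] <;> constructor <;> omega)
  exact ⟨z, fun t => hz t⟩

theorem vz_eq_iff (p q : Fin 4 → ℤ) : vz A B p = vz A B q ↔ ∀ l m, p l - q l = p m - q m := by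
  constructor
  · intro h
    have h0 := congrFun h 0
    have h1 := congrFun h 1
    have h2 := congrFun h 2
    simp [vz] at h0 h1 h2
    have e1 : p 1 - q 1 = p 0 - q 0 := by linarith
    rw [h2] at h0 h1
    have e2 : p 2 - q 2 = p 1 - q 1 := by linarith
    have e3 : p 2 - p 1 = q 2 - q 1 := by linarith
    rw [e3] at h0
    have e4 : p 3 - q 3 = p 2 - q 2 := by linarith
    have : ∀ l, p l - q l = p 0 - q 0 := by
      intro l; fin_cases l <;> simp <;> omega
    intro l m; rw [this l, this m]
  · intro h
    have h1 := h 1 0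
    have h2 := h 2 1
    have h3 := h 3 2
    have e1 : p 1 - p 0 = q 1 - q 0 := by omega
    have e2 : p 2 - p 1 = q 2 - q 1 := by omega
    have e3 : p 3 - p 2 = q 3 - q 2 := by omega
    simp only [vz, e1, e2, e3]

def ind (U : Finset (Fin 4)) : Fin 4 → ℤ := fun l => if l ∈ U then 1 else 0

theorem vz_zero : vz A B 0 = 0 := by funext i; fin_cases i <;> simp [vz]

def props : Finset (Finset (Fin 4)) := {U | U ≠ ∅ ∧ U ≠ Finset.univ}

theorem ind_inj : ∀ U ∈ props, ∀ V ∈ props, (∀ l m, ind U l - ind V l = ind U m - ind V m) → U = V := by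
  decide +kernel

theorem ind_ne : ∀ U ∈ props, ¬ (∀ l m, ind U l = ind U m) := by
  decide +kernel

theorem nbr_mem (hT : IsABCTile A B C T) (U : Finset (Fin 4)) (hU : U ∈ props) :
    vz A B (ind U) ∈ Neighbors T := by
  constructor
  · intro h
    rw [← vz_zero (A := A) (B := B), vz_eq_iff] at h
    exact ind_ne U hU (by simpa using h)
  · obtain ⟨x, hx⟩ := EE4_nonempty hT (ind U)
    have h0 := hx 0
    have h3 := hx 3
    have e0 : (fun l => (ind U l + 0) / 4) = 0 := by
      funext l; simp only [ind]; split_ifs <;> simp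
    have e3 : (fun l => (ind U l + 3) / 4) = ind U := by
      funext l; simp only [ind]; split_ifs <;> simp
    rw [e0] at h0
    rw [e3] at h3
    unfold In at h0 h3
    rw [vz_zero] at h0
    refine ⟨x, ?_, _, h3, by simp⟩
    convert h0 using 1
    funext i; simp [toR]

theorem nbr_eq (hT : IsABCTile A B C T) (h14 : (Neighbors T).ncard = 14) :
    Neighbors T = (fun U => vz A B (ind U)) '' (props : Set (Finset (Fin 4))) := by
  symm
  refine Set.eq_of_subset_of_ncard_le ?_ ?_ (Set.finite_of_ncard_ne_zero (by omega))
  · rintro _ ⟨U, hU, rfl⟩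
    exact nbr_mem hT U hU
  · rw [h14, Set.InjOn.ncard_image, Set.ncard_coe_finset]
    · decide +kernel
    · intro U hU V hV h
      exact ind_inj U hU V hV ((vz_eq_iff _ _).1 h)

theorem F3 (hT : IsABCTile A B C T) (h14 : (Neighbors T).ncard = 14) {x : Fin 3 → ℝ}
    {p q : Fin 4 → ℤ} (hp : In T A B x p) (hq : In T A B x q) (l m : Fin 4) :
    (p l - q l) - (p m - q m) ≤ 1 := by
  by_cases h : vz A B (p - q) = 0
  · rw [← vz_zero (A := A) (B := B), vz_eq_iff] at h
    have := h l m
    simp at this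
    omega
  · have hn : vz A B (p - q) ∈ Neighbors T := by
      refine ⟨h, x - toR (vz A B q), hq, _, hp, ?_⟩
      simp only [vz_sub, toR_sub]
      abel
    rw [nbr_eq hT h14] at hn
    obtain ⟨U, hU, e⟩ := hn
    simp only at e
    rw [vz_eq_iff] at e
    have := e l m
    simp only [Pi.sub_apply, ind] at this
    split_ifs at this <;> omega

def per (n : ℕ) : ℤ := if n % 4 = 0 then 0 else if n % 4 = 2 then 2 else 1

def bpath (A C : ℤ) : ℕ → Fin 4 → ℤ
  | 0 => 0
  | n+1 => ![bpath A C n 1, bpath A C n 2, bpath A C n 3,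
      max 0 (-((C - A) * per (n+1) + (A - 1) * per (n+3) + per (n+4) - C * per n))
        + C * bpath A C n 0 - ((C - A) * bpath A C n 1 + (A - 1) * bpath A C n 3)]

theorem per_e (hA : 1 ≤ A) (hC : A < C) (n : ℕ) :
    -C < (C - A) * per (n+1) + (A - 1) * per (n+3) + per (n+4) - C * per n ∧
    (C - A) * per (n+1) + (A - 1) * per (n+3) + per (n+4) - C * per n < C := by
  have h : n % 4 = 0 ∨ n % 4 = 1 ∨ n % 4 = 2 ∨ n % 4 = 3 := by omega
  rcases h with h | h | h | h <;> simp [per, h, Nat.add_mod] <;> (try constructor) <;> linarith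

theorem A_lt_B (hT : IsABCTile A B C T) (h14 : (Neighbors T).ncard = 14) : A < B := by
  by_contra hcon
  have hA := hT.1
  have hAB : B = A := by have := hT.2.1; omega
  subst hAB
  have hC := hT.2.2.1
  obtain ⟨z, hz⟩ := paths_point hT (J := Bool) false
    (fun b n l => bpath B C n l + if b then per (n + l) else 0)
    (fun b n => by
      have hp := per_e hA hC n
      refine ⟨?_, ?_, ?_, ?_⟩
      · cases b <;> simp [bpath, add_assoc]
      · cases b <;> simp [bpath, add_assoc]
      · cases b <;> simp [bpath, add_assoc]
      · cases b
        · simp [bpath]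
          have : max 0 (C * per n - ((C - B) * per (n+1) + (B - 1) * per (n+3) + per (n+4))) < C :=
            max_lt (by omega) (by omega)
          linarith
        · simp [bpath, add_assoc]
          rcases max_cases 0 (C * per n - ((C - B) * per (n+1) + ((B - 1) * per (n+3) + per (n+4)))) with ⟨h, h'⟩ | ⟨h, h'⟩ <;>
          rw [h] <;> constructor <;> linarith)
    (fun _ => 2)
    (fun b n l => by
      simp only [per]
      rw [abs_le]
      cases b <;> simp <;> split_ifs <;> norm_num)
  have h1 := hz false
  have h2 := hz true
  have := F3 hT h14 h2 h1 2 0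
  simp [per] at this

end Nbr


section E4
variable {A B C : ℤ} {T : Set (Fin 3 → ℝ)}

def D4 (k : Fin 4 → ℤ) : Prop :=
  (k 0 - k 1) % 4 ≠ 0 ∧ (k 0 - k 2) % 4 ≠ 0 ∧ (k 0 - k 3) % 4 ≠ 0 ∧
  (k 1 - k 2) % 4 ≠ 0 ∧ (k 1 - k 3) % 4 ≠ 0 ∧ (k 2 - k 3) % 4 ≠ 0

theorem D4_nx {k : Fin 4 → ℤ} (h : D4 k) : D4 (nx A B C k) := by
  unfold D4 at *
  rw [nx_0, nx_1, nx_2, nx_3]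
  generalize (C - B) * ((k 1 - k 0) / 4) + (B - A) * ((k 2 - k 0) / 4) +
    (A - 1) * ((k 3 - k 0) / 4) = κ
  omega

theorem pig4 (a b c d : ℤ) (h1 : (a - b) % 4 ≠ 0) (h2 : (a - c) % 4 ≠ 0) (h3 : (a - d) % 4 ≠ 0)
    (h4 : (b - c) % 4 ≠ 0) (h5 : (b - d) % 4 ≠ 0) (h6 : (c - d) % 4 ≠ 0) (h : a % 4 ≠ 3) :
    b % 4 = 3 ∨ c % 4 = 3 ∨ d % 4 = 3 := by omega

theorem fl4_lo (k u t : ℤ) (h : (u + t) % 4 = 0) :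
    (k + t) / 4 = (u + t) / 4 + (k - u) / 4 := by omega

theorem fl4_hi (k u t : ℤ) (h : (u + t) % 4 = 3) (h' : (u - k) % 4 ≠ 0) :
    (k + t) / 4 = (u + t) / 4 + (k - u) / 4 + 1 := by omega

theorem fwd4 (hT : IsABCTile A B C T) (h14 : (Neighbors T).ncard = 14) {k : Fin 4 → ℤ}
    (hk : D4 k) {x : Fin 3 → ℝ} (hx : x ∈ EE T A B 4 k) : Mf A B C x ∈ EE T A B 4 (nx A B C k) := by
  choose s hs using fun t => In_next hT (hx t)
  obtain ⟨k1, k2, k3, k4, k5, k6⟩ := hk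
  have mono : ∀ t, (k 0 + t) % 4 ≠ 3 → s t ≤ s (t+1) := by
    intro t ht
    have hF := fun m => F3 hT h14 (hs t).2 (hs (t+1)).2 3 m
    have f0 := hF 0
    have f1 := hF 1
    have f2 := hF 2
    simp at f0 f1 f2
    rcases pig4 (k 0 + t) (k 1 + t) (k 2 + t) (k 3 + t) (by simpa using k1) (by simpa using k2)
      (by simpa using k3) (by simpa using k4) (by simpa using k5) (by simpa using k6) ht with h | h | h
    · clear f1 f2; omega
    · clear f0 f2; omega
    · clear f0 f1; omega
  set N := (C - B) * ((k 1 - k 0) / 4) + (B - A) * ((k 2 - k 0) / 4) +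
    (A - 1) * ((k 3 - k 0) / 4) with hN
  have lo : ∀ t, (k 0 + t) % 4 = 0 → (k 0 + t) / 4 - N ≤ s t := by
    intro t ht
    have := (hs t).1.2.2.2.1
    simp only [fl4_lo (k 1) (k 0) _ ht, fl4_lo (k 2) (k 0) _ ht, fl4_lo (k 3) (k 0) _ ht] at this
    simp at this
    linarith
  have hi : ∀ t, (k 0 + t) % 4 = 3 → s t ≤ (k 0 + t) / 4 - N := by
    intro t ht
    have := (hs t).1.2.2.2.2
    simp only [fl4_hi _ _ _ ht k1, fl4_hi _ _ _ ht k2, fl4_hi _ _ _ ht k3] at this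
    simp at this
    linarith
  have key : ∀ t, s t = (k 0 + t) / 4 - N := by
    intro t
    obtain ⟨t0, ht0, h⟩ : ∃ t0, (k 0 + t0) % 4 = 0 ∧ (t = t0 ∨ t = t0 + 1 ∨ t = t0 + 1 + 1 ∨ t = t0 + 1 + 1 + 1) :=
      ⟨t - (k 0 + t) % 4, by omega, by omega⟩
    have m0 := mono t0 (by omega)
    have m1 := mono (t0 + 1) (by omega)
    have m2 := mono (t0 + 1 + 1) (by omega)
    have l := lo t0 ht0
    have h' := hi (t0 + 1 + 1 + 1) (by omega)
    rcases h with rfl | rfl | rfl | rfl <;> omega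
  intro t
  refine In_ext (hs t).2 rfl rfl rfl ?_
  simp only [nx_3, ← hN]
  have := key t
  simp
  omega

theorem EE_compact (hT : IsABCTile A B C T) (m : ℤ) (k : Fin 4 → ℤ) : IsCompact (EE T A B m k) := by
  have : EE T A B m k = ⋂ t : ℤ, {x | In T A B x (fun l => (k l + t) / m)} := by
    ext x; simp [EE]
  refine (In_isCompact hT (fun l => (k l + 0) / m)).of_isClosed_subset ?_ (fun x hx => hx 0)
  rw [this]
  exact isClosed_iInter fun t => In_isClosed hT _

theorem EE4_unique (hT : IsABCTile A B C T) (h14 : (Neighbors T).ncard = 14) {k : Fin 4 → ℤ}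
    (hk : D4 k) {x y : Fin 3 → ℝ} (hx : x ∈ EE T A B 4 k) (hy : y ∈ EE T A B 4 k) : x = y := by
  obtain ⟨K, hK⟩ := In_bound hT
  have it : ∀ n, D4 ((nx A B C)^[n] k) ∧ ∀ x ∈ EE T A B 4 k,
      (Mf A B C)^[n] x ∈ EE T A B 4 ((nx A B C)^[n] k) := by
    intro n
    induction n with
    | zero => exact ⟨hk, fun x hx => hx⟩
    | succ n ih =>
      simp only [Function.iterate_succ_apply']
      exact ⟨D4_nx ih.1, fun x hx => fwd4 hT h14 ih.1 (ih.2 x hx)⟩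
  refine Mf_exp (K := K) hT.1 hT.2.1 hT.2.2.1 fun n => ?_
  exact hK _ _ _ ((it n).2 x hx 0) ((it n).2 y hy 0)

noncomputable def pt (hT : IsABCTile A B C T) (k : Fin 4 → ℤ) : Fin 3 → ℝ :=
  (EE4_nonempty hT k).some

theorem pt_mem (hT : IsABCTile A B C T) (k : Fin 4 → ℤ) : pt hT k ∈ EE T A B 4 k :=
  (EE4_nonempty hT k).some_mem

theorem EE_const {m : ℤ} {k k' : Fin 4 → ℤ} (c : ℤ) (h0 : k' 0 = k 0 + c) (h1 : k' 1 = k 1 + c)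
    (h2 : k' 2 = k 2 + c) (h3 : k' 3 = k 3 + c) {x : Fin 3 → ℝ}
    (hx : x ∈ EE T A B m k) : x ∈ EE T A B m k' := by
  intro t
  refine In_ext (hx (c + t)) ?_ ?_ ?_ ?_ <;> simp only [h0, h1, h2, h3, add_assoc]

/-- E3 -/
def lo3 (A B C : ℤ) (h : Fin 4 → ℤ) : ℤ :=
  h 0 - 3 * ((C - B) * ((h 1 - h 0) / 3) + (B - A) * ((h 2 - h 0) / 3) + (A - 1) * ((h 3 - h 0) / 3))

def hi3 (A B C : ℤ) (h : Fin 4 → ℤ) : ℤ :=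
  h 0 - 3 * ((C - B) * ((h 1 - h 0 - 1) / 3) + (B - A) * ((h 2 - h 0 - 1) / 3)
    + (A - 1) * ((h 3 - h 0 - 1) / 3))

theorem fl3_lo (k u t : ℤ) : (u + t) / 3 + (k - u) / 3 ≤ (k + t) / 3 := by omega
theorem fl3_hi (k u t : ℤ) : (k + t) / 3 ≤ (u + t) / 3 + (k - u - 1) / 3 + 1 := by omega
theorem fl3_lo' (k u t : ℤ) (h : (u + t) % 3 = 0) : (k + t) / 3 = (u + t) / 3 + (k - u) / 3 := by omega
theorem fl3_hi' (k u t : ℤ) (h : (u + t) % 3 = 2) : (k + t) / 3 = (u + t) / 3 + (k - u - 1) / 3 + 1 := by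
  omega

theorem gstep3 (hA : 1 ≤ A) (hB : A ≤ B) (hC : B < C) (h : Fin 4 → ℤ) (s t : ℤ)
    (hs : lo3 A B C h ≤ s) (hs' : s ≤ hi3 A B C h) :
    GStep A B C (fun l => (h l + t) / 3) (fun l => ((![h 1, h 2, h 3, s] : Fin 4 → ℤ) l + t) / 3) := by
  refine ⟨rfl, rfl, rfl, ?_⟩
  simp
  have e : ∀ κ : ℤ, (h 0 - 3 * κ + t) / 3 = (h 0 + t) / 3 - κ := by intro κ; omega
  have a1 : (lo3 A B C h + t) / 3 ≤ (s + t) / 3 := by omega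
  have a2 : (s + t) / 3 ≤ (hi3 A B C h + t) / 3 := by omega
  rw [lo3, e] at a1
  rw [hi3, e] at a2
  have w1 : 0 ≤ C - B := by omega
  have w2 : 0 ≤ B - A := by omega
  have w3 : 0 ≤ A - 1 := by omega
  have b1 := mul_le_mul_of_nonneg_left (fl3_lo (h 1) (h 0) t) w1
  have b2 := mul_le_mul_of_nonneg_left (fl3_lo (h 2) (h 0) t) w2
  have b3 := mul_le_mul_of_nonneg_left (fl3_lo (h 3) (h 0) t) w3
  have c1 := mul_le_mul_of_nonneg_left (fl3_hi (h 1) (h 0) t) w1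
  have c2 := mul_le_mul_of_nonneg_left (fl3_hi (h 2) (h 0) t) w2
  have c3 := mul_le_mul_of_nonneg_left (fl3_hi (h 3) (h 0) t) w3
  constructor <;> linarith

theorem bwd3 (hT : IsABCTile A B C T) {h : Fin 4 → ℤ} {s : ℤ}
    (hs : lo3 A B C h ≤ s) (hs' : s ≤ hi3 A B C h) {x : Fin 3 → ℝ}
    (hx : Mf A B C x ∈ EE T A B 3 ![h 1, h 2, h 3, s]) : x ∈ EE T A B 3 h :=
  fun t => In_step hT (gstep3 hT.1 hT.2.1 hT.2.2.1 h s t hs hs') (hx t)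

/-- all residues mod 3 occur -/
def S3 (h : Fin 4 → ℤ) : Prop := ∀ r : ℤ, (h 0 - r) % 3 = 0 ∨ (h 1 - r) % 3 = 0 ∨
  (h 2 - r) % 3 = 0 ∨ (h 3 - r) % 3 = 0

theorem fwd3 (hT : IsABCTile A B C T) (h14 : (Neighbors T).ncard = 14) {h : Fin 4 → ℤ}
    (hh : S3 h) {x : Fin 3 → ℝ} (hx : x ∈ EE T A B 3 h) :
    ∃ s, lo3 A B C h ≤ s ∧ s ≤ hi3 A B C h ∧ Mf A B C x ∈ EE T A B 3 ![h 1, h 2, h 3, s] := by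
  choose s' hs' using fun t => In_next hT (hx t)
  -- normalised choice with period three
  set s : ℤ → ℤ := fun t => s' ((h 0 + t) % 3 - h 0) + (h 0 + t) / 3 with hsdef
  have hs : ∀ t, GStep A B C (fun l => (h l + t) / 3)
      ![(h 1 + t) / 3, (h 2 + t) / 3, (h 3 + t) / 3, s t] ∧
      In T A B (Mf A B C x) ![(h 1 + t) / 3, (h 2 + t) / 3, (h 3 + t) / 3, s t] := by
    intro t
    obtain ⟨⟨-, -, -, g1, g2⟩, g3⟩ := hs' ((h 0 + t) % 3 - h 0)
    have e : ∀ l, (h l + t) / 3 = (h l + ((h 0 + t) % 3 - h 0)) / 3 + (h 0 + t) / 3 := by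
      intro l; omega
    simp at g1 g2
    have e0 := e 0
    have e1 := e 1
    have e2 := e 2
    have e3 := e 3
    generalize (h 0 + t) / 3 = c at *
    have es : s t = s' ((h 0 + t) % 3 - h 0) + c := by simp only [hsdef]; omega
    have e0' : h 0 + ((h 0 + t) % 3 - h 0) = (h 0 + t) % 3 := by ring
    rw [e0'] at e0
    constructor
    · refine ⟨rfl, rfl, rfl, ?_⟩
      simp
      rw [es, e1, e2, e3]
      rw [show (h 0 + t) / 3 = (h 0 + t) % 3 / 3 + c by omega]
      constructor <;> linarith
    · refine In_const g3 c ?_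
      intro l
      fin_cases l
      · exact e1
      · exact e2
      · exact e3
      · exact es
  have per3 : ∀ t, s (t + 3) = s t + 1 := by
    intro t
    simp only [hsdef]
    rw [show (h 0 + (t + 3)) % 3 = (h 0 + t) % 3 by omega]
    omega
  clear_value s
  clear hsdef hs' s'
  have mono : ∀ t, (h 0 + t) % 3 ≠ 2 ∨ (h 1 - h 0) % 3 = 0 ∨ (h 2 - h 0) % 3 = 0 ∨
      (h 3 - h 0) % 3 = 0 → s t ≤ s (t+1) := by
    intro t ht
    have hF := fun m => F3 hT h14 (hs t).2 (hs (t+1)).2 3 m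
    have f0 := hF 0
    have f1 := hF 1
    have f2 := hF 2
    simp at f0 f1 f2
    have : (h 1 + t) % 3 = 2 ∨ (h 2 + t) % 3 = 2 ∨ (h 3 + t) % 3 = 2 := by
      have := hh (2 - t); omega
    rcases this with h | h | h
    · clear f1 f2; omega
    · clear f0 f2; omega
    · clear f0 f1; omega
  set N := (C - B) * ((h 1 - h 0) / 3) + (B - A) * ((h 2 - h 0) / 3) +
    (A - 1) * ((h 3 - h 0) / 3) with hN
  set N' := (C - B) * ((h 1 - h 0 - 1) / 3) + (B - A) * ((h 2 - h 0 - 1) / 3) +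
    (A - 1) * ((h 3 - h 0 - 1) / 3) with hN'
  have lo : ∀ t, (h 0 + t) % 3 = 0 → (h 0 + t) / 3 - N ≤ s t := by
    intro t ht
    have := (hs t).1.2.2.2.1
    simp only [fl3_lo' (h 1) (h 0) _ ht, fl3_lo' (h 2) (h 0) _ ht, fl3_lo' (h 3) (h 0) _ ht] at this
    simp at this
    linarith
  have hi : ∀ t, (h 0 + t) % 3 = 2 → s t ≤ (h 0 + t) / 3 - N' := by
    intro t ht
    have := (hs t).1.2.2.2.2
    simp only [fl3_hi' (h 1) (h 0) _ ht, fl3_hi' (h 2) (h 0) _ ht, fl3_hi' (h 3) (h 0) _ ht] at this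
    simp at this
    linarith
  have NN : (h 1 - h 0) % 3 = 0 ∨ (h 2 - h 0) % 3 = 0 ∨ (h 3 - h 0) % 3 = 0 ∨ N' = N := by
    by_cases c1 : (h 1 - h 0) % 3 = 0; · tauto
    by_cases c2 : (h 2 - h 0) % 3 = 0; · tauto
    by_cases c3 : (h 3 - h 0) % 3 = 0; · tauto
    right; right; right
    rw [hN, hN', show (h 1 - h 0 - 1) / 3 = (h 1 - h 0) / 3 by omega,
      show (h 2 - h 0 - 1) / 3 = (h 2 - h 0) / 3 by omega,
      show (h 3 - h 0 - 1) / 3 = (h 3 - h 0) / 3 by omega]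
  have m0 := mono (-h 0) (by omega)
  have m1 := mono (-h 0 + 1) (by omega)
  have l0 := lo (-h 0) (by omega)
  have h2 := hi (-h 0 + 1 + 1) (by omega)
  have m2 : s (-h 0 + 1 + 1) ≤ s (-h 0) + 1 := by
    by_cases c : (h 1 - h 0) % 3 = 0 ∨ (h 2 - h 0) % 3 = 0 ∨ (h 3 - h 0) % 3 = 0
    · have := mono (-h 0 + 1 + 1) (Or.inr c)
      have p := per3 (-h 0)
      rw [show -h 0 + 1 + 1 + 1 = -h 0 + 3 by ring] at this
      omega
    · have : N' = N := by tauto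
      omega
  -- the number
  refine ⟨s (-h 0) + s (-h 0 + 1) + s (-h 0 + 1 + 1) + h 0, ?_, ?_, ?_⟩
  · rw [lo3, ← hN]; omega
  · rw [hi3, ← hN']; omega
  · intro t
    refine In_ext (hs t).2 rfl rfl rfl ?_
    simp
    have q : ∀ n : ℕ, ∀ t, s (t + 3 * n) = s t + n := by
      intro n
      induction n with
      | zero => simp
      | succ n ih =>
        intro t
        push_cast
        rw [show t + 3 * ((n:ℤ) + 1) = (t + 3 * n) + 3 by ring, per3, ih]; ring
    have q' : ∀ n : ℤ, ∀ t, s (t + 3 * n) = s t + n := by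
      intro n t
      obtain ⟨m, rfl | rfl⟩ := n.eq_nat_or_neg
      · exact q m t
      · have := q m (t + 3 * -(m:ℤ))
        rw [show t + 3 * -(m:ℤ) + 3 * m = t by ring] at this
        omega
    have q2 := q' ((h 0 + t) / 3) (-h 0 + (h 0 + t) % 3)
    rw [show -h 0 + (h 0 + t) % 3 + 3 * ((h 0 + t) / 3) = t by omega] at q2
    rw [q2]
    rcases (show (h 0 + t) % 3 = 0 ∨ (h 0 + t) % 3 = 1 ∨ (h 0 + t) % 3 = 1 + 1 by omega) with e | e | e <;>
      rw [e] <;> (try rw [← add_assoc]) <;> (try rw [add_zero]) <;> omega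

end E4


section E3
variable {A B C : ℤ} {T : Set (Fin 3 → ℝ)}

def Kp (h : Fin 4 → ℤ) (j : Fin 4) : Fin 4 → ℤ :=
  fun l => if l = j then 1 else (4 * (h l - h j) + 2) / 3

def Km (h : Fin 4 → ℤ) (j : Fin 4) : Fin 4 → ℤ :=
  fun l => if l = j then 0 else (4 * (h l - h j)) / 3 + 1

/-- `i, j` is the pair of equal residues mod three, `k, l` the two other indices -/
def Pr (h : Fin 4 → ℤ) (i j k l : Fin 4) : Prop :=
  (h i - h j) % 3 = 0 ∧ (h i - h k) % 3 ≠ 0 ∧ (h i - h l) % 3 ≠ 0 ∧ (h k - h l) % 3 ≠ 0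

theorem S3_cases {h : Fin 4 → ℤ} (hh : S3 h) : Pr h 0 1 2 3 ∨ Pr h 0 2 1 3 ∨ Pr h 0 3 1 2 ∨
    Pr h 1 2 0 3 ∨ Pr h 1 3 0 2 ∨ Pr h 2 3 0 1 := by
  have h0 := hh 0
  have h1 := hh 1
  have h2 := hh 2
  unfold Pr
  generalize h 0 = a at *
  generalize h 1 = b at *
  generalize h 2 = c at *
  generalize h 3 = d at *
  rcases (show a % 3 = 0 ∨ a % 3 = 1 ∨ a % 3 = 2 by omega) with ha | ha | ha <;>
  rcases (show b % 3 = 0 ∨ b % 3 = 1 ∨ b % 3 = 2 by omega) with hb | hb | hb <;>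
  rcases (show c % 3 = 0 ∨ c % 3 = 1 ∨ c % 3 = 2 by omega) with hc | hc | hc <;>
  rcases (show d % 3 = 0 ∨ d % 3 = 1 ∨ d % 3 = 2 by omega) with hd | hd | hd <;>
  simp [Int.sub_emod, ha, hb, hc, hd] at h0 h1 h2 ⊢

theorem S3_of_3 {a b c : ℤ} (h1 : (a - b) % 3 ≠ 0) (h2 : (a - c) % 3 ≠ 0) (h3 : (b - c) % 3 ≠ 0)
    (s : ℤ) : S3 ![a, b, c, s] := by
  intro r
  simp
  omega

theorem EE_Kp (h : Fin 4 → ℤ) (j : Fin 4) {x : Fin 3 → ℝ} (hx : x ∈ EE T A B 4 (Kp h j)) :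
    x ∈ EE T A B 3 h := by
  intro t
  have := hx (4 * ((h j + t) / 3) + (h j + t) % 3)
  convert this using 2 with l
  simp only [Kp]
  split_ifs with hl
  · subst hl; omega
  · omega

theorem EE_Km (h : Fin 4 → ℤ) (j : Fin 4) {x : Fin 3 → ℝ} (hx : x ∈ EE T A B 4 (Km h j)) :
    x ∈ EE T A B 3 h := by
  intro t
  have := hx (4 * ((h j + t) / 3) + (h j + t) % 3)
  convert this using 2 with l
  simp only [Km]
  split_ifs with hl
  · subst hl; omega
  · omega

theorem far3 (hT : IsABCTile A B C T) (h14 : (Neighbors T).ncard = 14) {a b c s s' : ℤ}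
    (h1 : (a - b) % 3 ≠ 0) (h2 : (a - c) % 3 ≠ 0) (h3 : (b - c) % 3 ≠ 0) (hs : s + 2 ≤ s')
    {x : Fin 3 → ℝ} (hx : x ∈ EE T A B 3 ![a, b, c, s]) (hx' : x ∈ EE T A B 3 ![a, b, c, s']) :
    False := by
  have hF := fun l => F3 hT h14 (hx (2 * (s + 1))) (hx' (2 * (s + 1) - 1)) l 3
  have f0 := hF 0
  have f1 := hF 1
  have f2 := hF 2
  simp at f0 f1 f2
  have : (a + 2 * (s + 1)) % 3 = 0 ∨ (b + 2 * (s + 1)) % 3 = 0 ∨ (c + 2 * (s + 1)) % 3 = 0 := by omega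
  rcases this with h | h | h
  · clear f1 f2; omega
  · clear f0 f2; omega
  · clear f0 f1; omega

theorem adj3 {a b c s : ℤ}
    (h1 : (a - b) % 3 ≠ 0) (h2 : (a - c) % 3 ≠ 0) (h3 : (b - c) % 3 ≠ 0)
    {x : Fin 3 → ℝ} (hx : x ∈ EE T A B 3 ![a, b, c, s]) (hx' : x ∈ EE T A B 3 ![a, b, c, s + 1]) :
    x ∈ EE T A B 4 (Kp ![a, b, c, s] 3) := by
  intro t
  by_cases ht : t % 4 = 3
  · refine In_ext (hx' (-s + 3 * (t / 4) + 2)) ?_ ?_ ?_ ?_ <;> simp [Kp] <;> omega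
  · refine In_ext (hx (-s + 3 * (t / 4) + t % 4)) ?_ ?_ ?_ ?_ <;> simp [Kp] <;> omega

theorem Kp_Km (a b c s : ℤ) {x : Fin 3 → ℝ} (h : x ∈ EE T A B 4 (Kp ![a, b, c, s] 3)) :
    x ∈ EE T A B 4 (Km ![a, b, c, s + 1] 3) := by
  refine EE_const (-1) ?_ ?_ ?_ ?_ h <;> simp [Kp, Km] <;> omega

theorem Km_Kp (a b c s : ℤ) {x : Fin 3 → ℝ} (h : x ∈ EE T A B 4 (Km ![a, b, c, s + 1] 3)) :
    x ∈ EE T A B 4 (Kp ![a, b, c, s] 3) := by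
  refine EE_const 1 ?_ ?_ ?_ ?_ h <;> simp [Kp, Km] <;> omega

def jj (h : Fin 4 → ℤ) : Fin 4 :=
  if (h 0 - h 3) % 3 = 0 ∨ (h 1 - h 3) % 3 = 0 ∨ (h 2 - h 3) % 3 = 0 then 3
  else if (h 0 - h 2) % 3 = 0 ∨ (h 1 - h 2) % 3 = 0 then 2 else 1

theorem jj_01 {h : Fin 4 → ℤ} (H : Pr h 0 1 2 3) : jj h = 1 := by
  unfold Pr at H; unfold jj
  rw [if_neg (by omega), if_neg (by omega)]
theorem jj_02 {h : Fin 4 → ℤ} (H : Pr h 0 2 1 3) : jj h = 2 := by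
  unfold Pr at H; unfold jj
  rw [if_neg (by omega), if_pos (by omega)]
theorem jj_12 {h : Fin 4 → ℤ} (H : Pr h 1 2 0 3) : jj h = 2 := by
  unfold Pr at H; unfold jj
  rw [if_neg (by omega), if_pos (by omega)]
theorem jj_03 {h : Fin 4 → ℤ} (H : Pr h 0 3 1 2) : jj h = 3 := by
  unfold Pr at H; unfold jj
  rw [if_pos (by omega)]
theorem jj_13 {h : Fin 4 → ℤ} (H : Pr h 1 3 0 2) : jj h = 3 := by
  unfold Pr at H; unfold jj
  rw [if_pos (by omega)]
theorem jj_23 {h : Fin 4 → ℤ} (H : Pr h 2 3 0 1) : jj h = 3 := by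
  unfold Pr at H; unfold jj
  rw [if_pos (by omega)]

theorem jj_g {a b c : ℤ} (h1 : (a - b) % 3 ≠ 0) (h2 : (a - c) % 3 ≠ 0) (h3 : (b - c) % 3 ≠ 0)
    (s : ℤ) : jj ![a, b, c, s] = 3 := by
  unfold jj
  simp
  omega

theorem kpm (d : ℤ) : (d % 3 = 0 ∧ ((4 * d + 2) / 3) % 4 = 0) ∨ (d % 3 = 1 ∧ ((4 * d + 2) / 3) % 4 = 2) ∨
    (d % 3 = 2 ∧ ((4 * d + 2) / 3) % 4 = 3) := by
  rcases (show d % 3 = 0 ∨ d % 3 = 1 ∨ d % 3 = 2 by omega) with h | h | h <;> simp [h] <;> omega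
theorem kmm (d : ℤ) : (d % 3 = 0 ∧ ((4 * d) / 3) % 4 = 0) ∨ (d % 3 = 1 ∧ ((4 * d) / 3) % 4 = 1) ∨
    (d % 3 = 2 ∧ ((4 * d) / 3) % 4 = 2) := by
  rcases (show d % 3 = 0 ∨ d % 3 = 1 ∨ d % 3 = 2 by omega) with h | h | h <;> simp [h] <;> omega

theorem Pr_param {h : Fin 4 → ℤ} {i j k l : Fin 4} (H : Pr h i j k l) : ∃ a b c, h i = h j + 3 * a ∧
    ((h k = h j + 3 * b + 1 ∧ h l = h j + 3 * c + 2) ∨ (h k = h j + 3 * b + 2 ∧ h l = h j + 3 * c + 1)) := by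
  unfold Pr at H
  refine ⟨(h i - h j) / 3, (h k - h j) / 3, (h l - h j) / 3, by omega, ?_⟩
  generalize h i = a at *
  generalize h j = b at *
  generalize h k = c at *
  generalize h l = d at *
  obtain ⟨h1, h2, h3, h4⟩ := H
  have e1 : (c - b) % 3 ≠ 0 := by omega
  have e2 : (d - b) % 3 ≠ 0 := by omega
  rcases (show (c - b) % 3 = 1 ∨ (c - b) % 3 = 2 by omega) with h | h
  · left; omega
  · right; omega

theorem D4_Kp {h : Fin 4 → ℤ} (hh : S3 h) : D4 (Kp h (jj h)) := by
  rcases S3_cases hh with H | H | H | H | H | H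
  · rw [jj_01 H]; unfold Pr at H; unfold D4; simp [Kp]
    have q0 := kpm (h 0 - h 1)
    have q1 := kpm (h 2 - h 1)
    have q2 := kpm (h 3 - h 1)
    generalize (4 * (h 0 - h 1) + 2) / 3 = r0 at *
    generalize (4 * (h 2 - h 1) + 2) / 3 = r1 at *
    generalize (4 * (h 3 - h 1) + 2) / 3 = r2 at *
    rcases q0 with q0 | q0 | q0 <;> rcases q1 with q1 | q1 | q1 <;> rcases q2 with q2 | q2 | q2 <;> omega
  · rw [jj_02 H]; unfold Pr at H; unfold D4; simp [Kp]
    have q0 := kpm (h 0 - h 2)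
    have q1 := kpm (h 1 - h 2)
    have q2 := kpm (h 3 - h 2)
    generalize (4 * (h 0 - h 2) + 2) / 3 = r0 at *
    generalize (4 * (h 1 - h 2) + 2) / 3 = r1 at *
    generalize (4 * (h 3 - h 2) + 2) / 3 = r2 at *
    rcases q0 with q0 | q0 | q0 <;> rcases q1 with q1 | q1 | q1 <;> rcases q2 with q2 | q2 | q2 <;> omega
  · rw [jj_03 H]; unfold Pr at H; unfold D4; simp [Kp]
    have q0 := kpm (h 0 - h 3)
    have q1 := kpm (h 1 - h 3)
    have q2 := kpm (h 2 - h 3)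
    generalize (4 * (h 0 - h 3) + 2) / 3 = r0 at *
    generalize (4 * (h 1 - h 3) + 2) / 3 = r1 at *
    generalize (4 * (h 2 - h 3) + 2) / 3 = r2 at *
    rcases q0 with q0 | q0 | q0 <;> rcases q1 with q1 | q1 | q1 <;> rcases q2 with q2 | q2 | q2 <;> omega
  · rw [jj_12 H]; unfold Pr at H; unfold D4; simp [Kp]
    have q0 := kpm (h 0 - h 2)
    have q1 := kpm (h 1 - h 2)
    have q2 := kpm (h 3 - h 2)
    generalize (4 * (h 0 - h 2) + 2) / 3 = r0 at *
    generalize (4 * (h 1 - h 2) + 2) / 3 = r1 at *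
    generalize (4 * (h 3 - h 2) + 2) / 3 = r2 at *
    rcases q0 with q0 | q0 | q0 <;> rcases q1 with q1 | q1 | q1 <;> rcases q2 with q2 | q2 | q2 <;> omega
  · rw [jj_13 H]; unfold Pr at H; unfold D4; simp [Kp]
    have q0 := kpm (h 0 - h 3)
    have q1 := kpm (h 1 - h 3)
    have q2 := kpm (h 2 - h 3)
    generalize (4 * (h 0 - h 3) + 2) / 3 = r0 at *
    generalize (4 * (h 1 - h 3) + 2) / 3 = r1 at *
    generalize (4 * (h 2 - h 3) + 2) / 3 = r2 at *
    rcases q0 with q0 | q0 | q0 <;> rcases q1 with q1 | q1 | q1 <;> rcases q2 with q2 | q2 | q2 <;> omega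
  · rw [jj_23 H]; unfold Pr at H; unfold D4; simp [Kp]
    have q0 := kpm (h 0 - h 3)
    have q1 := kpm (h 1 - h 3)
    have q2 := kpm (h 2 - h 3)
    generalize (4 * (h 0 - h 3) + 2) / 3 = r0 at *
    generalize (4 * (h 1 - h 3) + 2) / 3 = r1 at *
    generalize (4 * (h 2 - h 3) + 2) / 3 = r2 at *
    rcases q0 with q0 | q0 | q0 <;> rcases q1 with q1 | q1 | q1 <;> rcases q2 with q2 | q2 | q2 <;> omega

theorem D4_Km {h : Fin 4 → ℤ} (hh : S3 h) : D4 (Km h (jj h)) := by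
  rcases S3_cases hh with H | H | H | H | H | H
  · rw [jj_01 H]; unfold Pr at H; unfold D4; simp [Km]
    have q0 := kmm (h 0 - h 1)
    have q1 := kmm (h 2 - h 1)
    have q2 := kmm (h 3 - h 1)
    generalize (4 * (h 0 - h 1)) / 3 = r0 at *
    generalize (4 * (h 2 - h 1)) / 3 = r1 at *
    generalize (4 * (h 3 - h 1)) / 3 = r2 at *
    rcases q0 with q0 | q0 | q0 <;> rcases q1 with q1 | q1 | q1 <;> rcases q2 with q2 | q2 | q2 <;> omega
  · rw [jj_02 H]; unfold Pr at H; unfold D4; simp [Km]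
    have q0 := kmm (h 0 - h 2)
    have q1 := kmm (h 1 - h 2)
    have q2 := kmm (h 3 - h 2)
    generalize (4 * (h 0 - h 2)) / 3 = r0 at *
    generalize (4 * (h 1 - h 2)) / 3 = r1 at *
    generalize (4 * (h 3 - h 2)) / 3 = r2 at *
    rcases q0 with q0 | q0 | q0 <;> rcases q1 with q1 | q1 | q1 <;> rcases q2 with q2 | q2 | q2 <;> omega
  · rw [jj_03 H]; unfold Pr at H; unfold D4; simp [Km]
    have q0 := kmm (h 0 - h 3)
    have q1 := kmm (h 1 - h 3)
    have q2 := kmm (h 2 - h 3)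
    generalize (4 * (h 0 - h 3)) / 3 = r0 at *
    generalize (4 * (h 1 - h 3)) / 3 = r1 at *
    generalize (4 * (h 2 - h 3)) / 3 = r2 at *
    rcases q0 with q0 | q0 | q0 <;> rcases q1 with q1 | q1 | q1 <;> rcases q2 with q2 | q2 | q2 <;> omega
  · rw [jj_12 H]; unfold Pr at H; unfold D4; simp [Km]
    have q0 := kmm (h 0 - h 2)
    have q1 := kmm (h 1 - h 2)
    have q2 := kmm (h 3 - h 2)
    generalize (4 * (h 0 - h 2)) / 3 = r0 at *
    generalize (4 * (h 1 - h 2)) / 3 = r1 at *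
    generalize (4 * (h 3 - h 2)) / 3 = r2 at *
    rcases q0 with q0 | q0 | q0 <;> rcases q1 with q1 | q1 | q1 <;> rcases q2 with q2 | q2 | q2 <;> omega
  · rw [jj_13 H]; unfold Pr at H; unfold D4; simp [Km]
    have q0 := kmm (h 0 - h 3)
    have q1 := kmm (h 1 - h 3)
    have q2 := kmm (h 2 - h 3)
    generalize (4 * (h 0 - h 3)) / 3 = r0 at *
    generalize (4 * (h 1 - h 3)) / 3 = r1 at *
    generalize (4 * (h 2 - h 3)) / 3 = r2 at *
    rcases q0 with q0 | q0 | q0 <;> rcases q1 with q1 | q1 | q1 <;> rcases q2 with q2 | q2 | q2 <;> omega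
  · rw [jj_23 H]; unfold Pr at H; unfold D4; simp [Km]
    have q0 := kmm (h 0 - h 3)
    have q1 := kmm (h 1 - h 3)
    have q2 := kmm (h 2 - h 3)
    generalize (4 * (h 0 - h 3)) / 3 = r0 at *
    generalize (4 * (h 1 - h 3)) / 3 = r1 at *
    generalize (4 * (h 2 - h 3)) / 3 = r2 at *
    rcases q0 with q0 | q0 | q0 <;> rcases q1 with q1 | q1 | q1 <;> rcases q2 with q2 | q2 | q2 <;> omega

theorem lo_aux {k h : Fin 4 → ℤ} (d1 : (k 1 - k 0) / 4 = (h 1 - h 0) / 3)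
    (d2 : (k 2 - k 0) / 4 = (h 2 - h 0) / 3) (d3 : (k 3 - k 0) / 4 = (h 3 - h 0) / 3) :
    ∃ N, nx A B C k 3 = k 0 - 4 * N ∧ lo3 A B C h = h 0 - 3 * N := by
  refine ⟨_, ?_, rfl⟩
  rw [nx_3, d1, d2, d3]

theorem hi_aux {k h : Fin 4 → ℤ} (d1 : (k 1 - k 0) / 4 = (h 1 - h 0 - 1) / 3)
    (d2 : (k 2 - k 0) / 4 = (h 2 - h 0 - 1) / 3) (d3 : (k 3 - k 0) / 4 = (h 3 - h 0 - 1) / 3) :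
    ∃ N, nx A B C k 3 = k 0 - 4 * N ∧ hi3 A B C h = h 0 - 3 * N := by
  refine ⟨_, ?_, rfl⟩
  rw [nx_3, d1, d2, d3]

def sp3 (h : Fin 4 → ℤ) : Prop := (h 1 - h 0) % 3 = 0 ∨ (h 2 - h 0) % 3 = 0 ∨ (h 3 - h 0) % 3 = 0

theorem sp3_dist {h : Fin 4 → ℤ} (hh : S3 h) (hs : sp3 h) :
    (h 1 - h 2) % 3 ≠ 0 ∧ (h 1 - h 3) % 3 ≠ 0 ∧ (h 2 - h 3) % 3 ≠ 0 := by
  unfold sp3 at hs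
  rcases S3_cases hh with H | H | H | H | H | H <;> unfold Pr at H <;> omega

theorem nsp3_eq {h : Fin 4 → ℤ} (hs : ¬ sp3 h) : hi3 A B C h = lo3 A B C h := by
  unfold sp3 at hs
  push Not at hs
  unfold hi3 lo3
  rw [show (h 1 - h 0 - 1) / 3 = (h 1 - h 0) / 3 by omega,
      show (h 2 - h 0 - 1) / 3 = (h 2 - h 0) / 3 by omega,
      show (h 3 - h 0 - 1) / 3 = (h 3 - h 0) / 3 by omega]

theorem lo3_le_hi3 (hA : 1 ≤ A) (hB : A ≤ B) (hC : B < C) (h : Fin 4 → ℤ) :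
    lo3 A B C h ≤ hi3 A B C h := by
  unfold hi3 lo3
  have w1 : 0 ≤ C - B := by omega
  have w2 : 0 ≤ B - A := by omega
  have w3 : 0 ≤ A - 1 := by omega
  have b1 := mul_le_mul_of_nonneg_left (show (h 1 - h 0 - 1) / 3 ≤ (h 1 - h 0) / 3 by omega) w1
  have b2 := mul_le_mul_of_nonneg_left (show (h 2 - h 0 - 1) / 3 ≤ (h 2 - h 0) / 3 by omega) w2
  have b3 := mul_le_mul_of_nonneg_left (show (h 3 - h 0 - 1) / 3 ≤ (h 3 - h 0) / 3 by omega) w3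
  linarith

theorem lo3_mod (h : Fin 4 → ℤ) : (lo3 A B C h - h 0) % 3 = 0 := by
  unfold lo3
  generalize (C - B) * ((h 1 - h 0) / 3) + (B - A) * ((h 2 - h 0) / 3) + (A - 1) * ((h 3 - h 0) / 3) = N
  omega

theorem S3_child {h : Fin 4 → ℤ} (hh : S3 h) {s : ℤ} (hs : sp3 h ∨ s = lo3 A B C h) :
    S3 ![h 1, h 2, h 3, s] := by
  rcases hs with hs | rfl
  · obtain ⟨h1, h2, h3⟩ := sp3_dist hh hs
    exact S3_of_3 h1 h2 h3 s
  · intro r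
    have := hh r
    have := lo3_mod (A := A) (B := B) (C := C) h
    simp
    omega

theorem jj_child {h : Fin 4 → ℤ} (hh : S3 h) (hs : sp3 h) (s : ℤ) : jj ![h 1, h 2, h 3, s] = 3 := by
  obtain ⟨h1, h2, h3⟩ := sp3_dist hh hs
  exact jj_g h1 h2 h3 s

/-- split, `true` end -/
theorem end_st {h : Fin 4 → ℤ} (hh : S3 h) (hs : sp3 h) {x : Fin 3 → ℝ}
    (hx : x ∈ EE T A B 4 (nx A B C (Kp h (jj h)))) :
    x ∈ EE T A B 4 (Km ![h 1, h 2, h 3, lo3 A B C h] 3) := by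
  unfold sp3 at hs
  rcases S3_cases hh with H | H | H | H | H | H
  · rw [jj_01 H] at hx; obtain ⟨a, b, c, ei, eo⟩ := Pr_param H
    obtain ⟨N, e1, e2⟩ := lo_aux (A := A) (B := B) (C := C) (k := Kp h 1) (h := h)
      (by simp [Kp]; omega) (by simp [Kp]; omega) (by simp [Kp]; omega)
    clear H
    rcases eo with ⟨ek, el⟩ | ⟨ek, el⟩ <;>
    refine EE_const (- nx A B C (Kp h 1) 3) ?_ ?_ ?_ ?_ hx <;>
      simp only [nx_0, nx_1, nx_2, e1] <;> simp [Km, Kp, e2] <;> omega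
  · rw [jj_02 H] at hx; obtain ⟨a, b, c, ei, eo⟩ := Pr_param H
    obtain ⟨N, e1, e2⟩ := lo_aux (A := A) (B := B) (C := C) (k := Kp h 2) (h := h)
      (by simp [Kp]; omega) (by simp [Kp]; omega) (by simp [Kp]; omega)
    clear H
    rcases eo with ⟨ek, el⟩ | ⟨ek, el⟩ <;>
    refine EE_const (- nx A B C (Kp h 2) 3) ?_ ?_ ?_ ?_ hx <;>
      simp only [nx_0, nx_1, nx_2, e1] <;> simp [Km, Kp, e2] <;> omega
  · rw [jj_03 H] at hx; obtain ⟨a, b, c, ei, eo⟩ := Pr_param H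
    obtain ⟨N, e1, e2⟩ := lo_aux (A := A) (B := B) (C := C) (k := Kp h 3) (h := h)
      (by simp [Kp]; omega) (by simp [Kp]; omega) (by simp [Kp]; omega)
    clear H
    rcases eo with ⟨ek, el⟩ | ⟨ek, el⟩ <;>
    refine EE_const (- nx A B C (Kp h 3) 3) ?_ ?_ ?_ ?_ hx <;>
      simp only [nx_0, nx_1, nx_2, e1] <;> simp [Km, Kp, e2] <;> omega
  all_goals (unfold Pr at H; omega)

/-- split, `false` end -/
theorem end_sf {h : Fin 4 → ℤ} (hh : S3 h) (hs : sp3 h) {x : Fin 3 → ℝ}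
    (hx : x ∈ EE T A B 4 (nx A B C (Km h (jj h)))) :
    x ∈ EE T A B 4 (Kp ![h 1, h 2, h 3, hi3 A B C h] 3) := by
  unfold sp3 at hs
  rcases S3_cases hh with H | H | H | H | H | H
  · rw [jj_01 H] at hx; obtain ⟨a, b, c, ei, eo⟩ := Pr_param H
    obtain ⟨N, e1, e2⟩ := hi_aux (A := A) (B := B) (C := C) (k := Km h 1) (h := h)
      (by simp [Km]; omega) (by simp [Km]; omega) (by simp [Km]; omega)
    clear H
    rcases eo with ⟨ek, el⟩ | ⟨ek, el⟩ <;>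
    refine EE_const (1 - nx A B C (Km h 1) 3) ?_ ?_ ?_ ?_ hx <;>
      simp only [nx_0, nx_1, nx_2, e1] <;> simp [Km, Kp, e2] <;> omega
  · rw [jj_02 H] at hx; obtain ⟨a, b, c, ei, eo⟩ := Pr_param H
    obtain ⟨N, e1, e2⟩ := hi_aux (A := A) (B := B) (C := C) (k := Km h 2) (h := h)
      (by simp [Km]; omega) (by simp [Km]; omega) (by simp [Km]; omega)
    clear H
    rcases eo with ⟨ek, el⟩ | ⟨ek, el⟩ <;>
    refine EE_const (1 - nx A B C (Km h 2) 3) ?_ ?_ ?_ ?_ hx <;>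
      simp only [nx_0, nx_1, nx_2, e1] <;> simp [Km, Kp, e2] <;> omega
  · rw [jj_03 H] at hx; obtain ⟨a, b, c, ei, eo⟩ := Pr_param H
    obtain ⟨N, e1, e2⟩ := hi_aux (A := A) (B := B) (C := C) (k := Km h 3) (h := h)
      (by simp [Km]; omega) (by simp [Km]; omega) (by simp [Km]; omega)
    clear H
    rcases eo with ⟨ek, el⟩ | ⟨ek, el⟩ <;>
    refine EE_const (1 - nx A B C (Km h 3) 3) ?_ ?_ ?_ ?_ hx <;>
      simp only [nx_0, nx_1, nx_2, e1] <;> simp [Km, Kp, e2] <;> omega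
  all_goals (unfold Pr at H; omega)

theorem jj_n12 {h : Fin 4 → ℤ} (H : Pr h 1 2 0 3) : jj ![h 1, h 2, h 3, lo3 A B C h] = 1 := by
  apply jj_01
  have := lo3_mod (A := A) (B := B) (C := C) h
  unfold Pr at H ⊢; simp; omega
theorem jj_n13 {h : Fin 4 → ℤ} (H : Pr h 1 3 0 2) : jj ![h 1, h 2, h 3, lo3 A B C h] = 2 := by
  apply jj_02
  have := lo3_mod (A := A) (B := B) (C := C) h
  unfold Pr at H ⊢; simp; omega
theorem jj_n23 {h : Fin 4 → ℤ} (H : Pr h 2 3 0 1) : jj ![h 1, h 2, h 3, lo3 A B C h] = 2 := by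
  apply jj_12
  have := lo3_mod (A := A) (B := B) (C := C) h
  unfold Pr at H ⊢; simp; omega

/-- not split, `true` end -/
theorem end_nt {h : Fin 4 → ℤ} (hh : S3 h) (hs : ¬ sp3 h) {x : Fin 3 → ℝ}
    (hx : x ∈ EE T A B 4 (nx A B C (Kp h (jj h)))) :
    x ∈ EE T A B 4 (Kp ![h 1, h 2, h 3, lo3 A B C h] (jj ![h 1, h 2, h 3, lo3 A B C h])) := by
  unfold sp3 at hs
  rcases S3_cases hh with H | H | H | H | H | H
  · unfold Pr at H; omega
  · unfold Pr at H; omega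
  · unfold Pr at H; omega
  · rw [jj_12 H] at hx; rw [jj_n12 H]; obtain ⟨a, b, c, ei, eo⟩ := Pr_param H
    obtain ⟨N, e1, e2⟩ := lo_aux (A := A) (B := B) (C := C) (k := Kp h 2) (h := h)
      (by simp [Kp]; omega) (by simp [Kp]; omega) (by simp [Kp]; omega)
    clear H
    rcases eo with ⟨ek, el⟩ | ⟨ek, el⟩ <;>
    refine EE_const 0 ?_ ?_ ?_ ?_ hx <;>
      simp only [nx_0, nx_1, nx_2, e1] <;> simp [Kp, e2] <;> omega
  · rw [jj_13 H] at hx; rw [jj_n13 H]; obtain ⟨a, b, c, ei, eo⟩ := Pr_param H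
    obtain ⟨N, e1, e2⟩ := lo_aux (A := A) (B := B) (C := C) (k := Kp h 3) (h := h)
      (by simp [Kp]; omega) (by simp [Kp]; omega) (by simp [Kp]; omega)
    clear H
    rcases eo with ⟨ek, el⟩ | ⟨ek, el⟩ <;>
    refine EE_const 0 ?_ ?_ ?_ ?_ hx <;>
      simp only [nx_0, nx_1, nx_2, e1] <;> simp [Kp, e2] <;> omega
  · rw [jj_23 H] at hx; rw [jj_n23 H]; obtain ⟨a, b, c, ei, eo⟩ := Pr_param H
    obtain ⟨N, e1, e2⟩ := lo_aux (A := A) (B := B) (C := C) (k := Kp h 3) (h := h)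
      (by simp [Kp]; omega) (by simp [Kp]; omega) (by simp [Kp]; omega)
    clear H
    rcases eo with ⟨ek, el⟩ | ⟨ek, el⟩ <;>
    refine EE_const 0 ?_ ?_ ?_ ?_ hx <;>
      simp only [nx_0, nx_1, nx_2, e1] <;> simp [Kp, e2] <;> omega

/-- not split, `false` end -/
theorem end_nf {h : Fin 4 → ℤ} (hh : S3 h) (hs : ¬ sp3 h) {x : Fin 3 → ℝ}
    (hx : x ∈ EE T A B 4 (nx A B C (Km h (jj h)))) :
    x ∈ EE T A B 4 (Km ![h 1, h 2, h 3, lo3 A B C h] (jj ![h 1, h 2, h 3, lo3 A B C h])) := by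
  unfold sp3 at hs
  rcases S3_cases hh with H | H | H | H | H | H
  · unfold Pr at H; omega
  · unfold Pr at H; omega
  · unfold Pr at H; omega
  · rw [jj_12 H] at hx; rw [jj_n12 H]; obtain ⟨a, b, c, ei, eo⟩ := Pr_param H
    obtain ⟨N, e1, e2⟩ := lo_aux (A := A) (B := B) (C := C) (k := Km h 2) (h := h)
      (by simp [Km]; omega) (by simp [Km]; omega) (by simp [Km]; omega)
    clear H
    rcases eo with ⟨ek, el⟩ | ⟨ek, el⟩ <;>
    refine EE_const 0 ?_ ?_ ?_ ?_ hx <;>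
      simp only [nx_0, nx_1, nx_2, e1] <;> simp [Km, e2] <;> omega
  · rw [jj_13 H] at hx; rw [jj_n13 H]; obtain ⟨a, b, c, ei, eo⟩ := Pr_param H
    obtain ⟨N, e1, e2⟩ := lo_aux (A := A) (B := B) (C := C) (k := Km h 3) (h := h)
      (by simp [Km]; omega) (by simp [Km]; omega) (by simp [Km]; omega)
    clear H
    rcases eo with ⟨ek, el⟩ | ⟨ek, el⟩ <;>
    refine EE_const 0 ?_ ?_ ?_ ?_ hx <;>
      simp only [nx_0, nx_1, nx_2, e1] <;> simp [Km, e2] <;> omega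
  · rw [jj_23 H] at hx; rw [jj_n23 H]; obtain ⟨a, b, c, ei, eo⟩ := Pr_param H
    obtain ⟨N, e1, e2⟩ := lo_aux (A := A) (B := B) (C := C) (k := Km h 3) (h := h)
      (by simp [Km]; omega) (by simp [Km]; omega) (by simp [Km]; omega)
    clear H
    rcases eo with ⟨ek, el⟩ | ⟨ek, el⟩ <;>
    refine EE_const 0 ?_ ?_ ?_ ?_ hx <;>
      simp only [nx_0, nx_1, nx_2, e1] <;> simp [Km, e2] <;> omega

end E3


section Arcs
variable {A B C : ℤ} {T : Set (Fin 3 → ℝ)}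

abbrev St := {h : Fin 4 → ℤ // S3 h}

noncomputable instance (h : Fin 4 → ℤ) : Decidable (sp3 h) := Classical.dec _

noncomputable def nS (A B C : ℤ) (v : St) : ℕ := (hi3 A B C v.1 - lo3 A B C v.1).toNat + 1

noncomputable def cS (A B C : ℤ) (v : St) (r : ℕ) : ℤ := lo3 A B C v.1 + if sp3 v.1 then (r : ℤ) else 0

noncomputable def chS (A B C : ℤ) (v : St) (r : ℕ) : St :=
  ⟨![v.1 1, v.1 2, v.1 3, cS A B C v r], S3_child (A := A) (B := B) (C := C) v.2 (by
    unfold cS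
    by_cases h : sp3 v.1
    · exact Or.inl h
    · right; simp [h])⟩

noncomputable def spS (v : St) : Bool := decide (sp3 v.1)

noncomputable def aS (hT : IsABCTile A B C T) (v : St) (b : Bool) : Fin 3 → ℝ :=
  if b then pt hT (Kp v.1 (jj v.1)) else pt hT (Km v.1 (jj v.1))

theorem aS_true (hT : IsABCTile A B C T) (v : St) : aS hT v true ∈ EE T A B 4 (Kp v.1 (jj v.1)) :=
  pt_mem hT _
theorem aS_false (hT : IsABCTile A B C T) (v : St) : aS hT v false ∈ EE T A B 4 (Km v.1 (jj v.1)) :=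
  pt_mem hT _

theorem aS_true_eq (hT : IsABCTile A B C T) (h14 : (Neighbors T).ncard = 14) (v : St) {x : Fin 3 → ℝ}
    (hx : x ∈ EE T A B 4 (Kp v.1 (jj v.1))) : x = aS hT v true :=
  EE4_unique hT h14 (D4_Kp v.2) hx (aS_true hT v)
theorem aS_false_eq (hT : IsABCTile A B C T) (h14 : (Neighbors T).ncard = 14) (v : St) {x : Fin 3 → ℝ}
    (hx : x ∈ EE T A B 4 (Km v.1 (jj v.1))) : x = aS hT v false :=
  EE4_unique hT h14 (D4_Km v.2) hx (aS_false hT v)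

theorem aS_mem (hT : IsABCTile A B C T) (v : St) (b : Bool) : aS hT v b ∈ EE T A B 3 v.1 := by
  cases b
  · exact EE_Km _ _ (aS_false hT v)
  · exact EE_Kp _ _ (aS_true hT v)

theorem sp_of_lt {v : St} {i : ℕ} (h : i + 1 < nS A B C v) : sp3 v.1 := by
  by_contra hs
  unfold nS at h
  rw [nsp3_eq hs] at h
  simp at h

theorem nS_one {v : St} (hs : ¬ sp3 v.1) : nS A B C v = 1 := by
  unfold nS; rw [nsp3_eq hs]; simp

theorem chS_val {v : St} (hs : sp3 v.1) (r : ℕ) :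
    (chS A B C v r).1 = ![v.1 1, v.1 2, v.1 3, lo3 A B C v.1 + r] := by
  simp [chS, cS, hs]

theorem chS_last (hT : IsABCTile A B C T) {v : St} (hs : sp3 v.1) :
    (chS A B C v (nS A B C v - 1)).1 = ![v.1 1, v.1 2, v.1 3, hi3 A B C v.1] := by
  rw [chS_val hs]
  have := lo3_le_hi3 hT.1 hT.2.1 hT.2.2.1 v.1
  have e : lo3 A B C v.1 + ((nS A B C v - 1 : ℕ) : ℤ) = hi3 A B C v.1 := by
    simp [nS]
    omega
  rw [e]

theorem chS_val' {v : St} (hs : ¬ sp3 v.1) (r : ℕ) :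
    (chS A B C v r).1 = ![v.1 1, v.1 2, v.1 3, lo3 A B C v.1] := by
  simp [chS, cS, hs]

theorem cover3 (hT : IsABCTile A B C T) (h14 : (Neighbors T).ncard = 14) (v : St) (x : Fin 3 → ℝ) :
    x ∈ EE T A B 3 v.1 ↔ ∃ i, i < nS A B C v ∧ ∃ x' ∈ EE T A B 3 (chS A B C v i).1, x = Mi A B C x' := by
  have hC : C ≠ 0 := by have := hT.1; have := hT.2.1; have := hT.2.2.1; omega
  constructor
  · intro hx
    obtain ⟨s, h1, h2, h3⟩ := fwd3 hT h14 v.2 hx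
    refine ⟨(s - lo3 A B C v.1).toNat, ?_, Mf A B C x, ?_, (Mi_Mf hC x).symm⟩
    · unfold nS; omega
    · by_cases hs : sp3 v.1
      · rw [chS_val hs]
        rwa [show lo3 A B C v.1 + ((s - lo3 A B C v.1).toNat : ℤ) = s by omega]
      · rw [chS_val' hs]
        have := nsp3_eq (A := A) (B := B) (C := C) hs
        rwa [show s = lo3 A B C v.1 by omega] at h3
  · rintro ⟨i, hi, x', hx', rfl⟩
    by_cases hs : sp3 v.1
    · rw [chS_val hs] at hx'
      refine bwd3 hT (s := lo3 A B C v.1 + i) (by omega) ?_ (by rwa [Mf_Mi hC])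
      have := lo3_le_hi3 hT.1 hT.2.1 hT.2.2.1 v.1
      unfold nS at hi; omega
    · rw [chS_val' hs] at hx'
      refine bwd3 hT (s := lo3 A B C v.1) le_rfl (lo3_le_hi3 hT.1 hT.2.1 hT.2.2.1 v.1) (by rwa [Mf_Mi hC])

theorem adjS (hT : IsABCTile A B C T) (h14 : (Neighbors T).ncard = 14) {v : St} (hs : sp3 v.1) (i : ℕ)
    {x : Fin 3 → ℝ} (hx : x ∈ EE T A B 3 (chS A B C v i).1) (hx' : x ∈ EE T A B 3 (chS A B C v (i+1)).1) :
    x = aS hT (chS A B C v i) true ∧ x = aS hT (chS A B C v (i+1)) false := by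
  obtain ⟨d1, d2, d3⟩ := sp3_dist v.2 hs
  rw [chS_val hs] at hx hx'
  push_cast at hx'
  rw [← add_assoc] at hx'
  have h := adj3 d1 d2 d3 hx hx'
  constructor
  · apply aS_true_eq hT h14
    rw [chS_val hs, jj_child v.2 hs]
    exact h
  · apply aS_false_eq hT h14
    rw [chS_val hs, jj_child v.2 hs]
    push_cast
    rw [← add_assoc]
    exact Kp_Km _ _ _ _ h

theorem adjpS (hT : IsABCTile A B C T) (h14 : (Neighbors T).ncard = 14) {v : St} (hs : sp3 v.1) (i : ℕ) :
    aS hT (chS A B C v i) true = aS hT (chS A B C v (i+1)) false := by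
  apply aS_false_eq hT h14
  have := aS_true hT (chS A B C v i)
  rw [chS_val hs, jj_child v.2 hs] at this ⊢
  push_cast
  rw [← add_assoc]
  exact Kp_Km _ _ _ _ this

theorem farS (hT : IsABCTile A B C T) (h14 : (Neighbors T).ncard = 14) {v : St} (hs : sp3 v.1) {i j : ℕ}
    (hij : i + 2 ≤ j) {x : Fin 3 → ℝ} (hx : x ∈ EE T A B 3 (chS A B C v i).1)
    (hx' : x ∈ EE T A B 3 (chS A B C v j).1) : False := by
  obtain ⟨d1, d2, d3⟩ := sp3_dist v.2 hs
  rw [chS_val hs] at hx hx'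
  exact far3 hT h14 d1 d2 d3 (by omega) hx hx'

theorem neS (hT : IsABCTile A B C T) (h14 : (Neighbors T).ncard = 14) {v : St} (hs : sp3 v.1) (i : ℕ) :
    aS hT (chS A B C v i) true ≠ aS hT (chS A B C v i) false := by
  intro h
  obtain ⟨d1, d2, d3⟩ := sp3_dist v.2 hs
  have h1 := aS_true hT (chS A B C v i)
  have h2 := aS_false hT (chS A B C v i)
  rw [← h] at h2
  rw [chS_val hs, jj_child v.2 hs] at h1 h2
  have h1' := EE_Km _ _ (Kp_Km _ _ _ _ h1)
  have h2' := EE_Kp _ _ (Km_Kp _ _ _ (lo3 A B C v.1 + i - 1) (by simpa using h2))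
  exact far3 hT h14 d1 d2 d3 (by omega) h2' h1'

theorem endsS (hT : IsABCTile A B C T) (h14 : (Neighbors T).ncard = 14) (v : St) (b : Bool) :
    Mf A B C (aS hT v b) = aS hT (chS A B C v (if b then 0 else nS A B C v - 1)) (xor (spS v) b) := by
  by_cases hs : sp3 v.1
  · have e : spS v = true := by simp [spS, hs]
    cases b
    · have := end_sf v.2 hs (fwd4 hT h14 (D4_Km v.2) (aS_false hT v))
      simp only [e, Bool.xor_false]
      apply aS_true_eq hT h14
      have hl := chS_last hT hs
      simp only [Bool.false_eq_true, if_false]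
      rw [hl, jj_child v.2 hs]
      exact this
    · have := end_st v.2 hs (fwd4 hT h14 (D4_Kp v.2) (aS_true hT v))
      simp only [e, Bool.xor_self]
      apply aS_false_eq hT h14
      simp only [if_true]
      rw [chS_val hs, jj_child v.2 hs]
      simpa using this
  · have e : spS v = false := by simp [spS, hs]
    cases b
    · have := end_nf v.2 hs (fwd4 hT h14 (D4_Km v.2) (aS_false hT v))
      simp only [e, Bool.xor_false]
      apply aS_false_eq hT h14
      rw [chS_val' hs]
      exact this
    · have := end_nt v.2 hs (fwd4 hT h14 (D4_Kp v.2) (aS_true hT v))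
      simp only [e, Bool.false_xor]
      apply aS_true_eq hT h14
      rw [chS_val' hs]
      exact this

theorem tile_sys (hT : IsABCTile A B C T) (h14 : (Neighbors T).ncard = 14) (K : ℝ)
    (hK : ∀ x y p, In T A B x p → In T A B y p → ‖x - y‖ ≤ K) :
    Sys (nS A B C) (chS A B C) spS (fun v => EE T A B 3 v.1) (fun _ _ => Mi A B C) (aS hT)
      (fun k x y => ‖(Mf A B C)^[k] x - (Mf A B C)^[k] y‖ ≤ K) := by
  have hC : C ≠ 0 := by have := hT.1; have := hT.2.1; have := hT.2.2.1; omega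
  have inj : ∀ x y, Mi A B C x = Mi A B C y → x = y := fun x y h => by
    rw [← Mf_Mi (A := A) (B := B) hC x, h, Mf_Mi hC]
  have ends : ∀ (v : St) (b : Bool), aS hT v b = Mi A B C
      (aS hT (chS A B C v (if b then 0 else nS A B C v - 1)) (xor (spS v) b)) := fun v b => by
    rw [← endsS hT h14 v b, Mi_Mf hC]
  refine ⟨cover3 hT h14, fun _ _ => inj, aS_mem hT, ?_, ?_, ?_, ends, ?_, ?_, ?_, ?_, ?_, ?_⟩
  · intro v i x y hi hx hy h
    obtain rfl := inj _ _ h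
    exact adjS hT h14 (sp_of_lt hi) i hx hy
  · intro v i hi
    rw [adjpS hT h14 (sp_of_lt hi)]
  · intro v i j x y hij hj hx hy h
    obtain rfl := inj _ _ h
    exact farS hT h14 (sp_of_lt (A := A) (B := B) (C := C) (i := j - 1) (by omega)) hij hx hy
  · intro v b i x hi hx h
    rw [ends v b] at h
    have hxe := inj _ _ h
    by_contra hne
    have hs : sp3 v.1 := by
      by_contra hs
      rw [nS_one hs] at hi hne
      apply hne
      cases b <;> simp <;> omega
    have e : spS v = true := by simp [spS, hs]
    rw [e] at hxe
    have hmem := aS_mem hT (chS A B C v (if b then 0 else nS A B C v - 1)) (xor true b)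
    rw [← hxe] at hmem
    cases b
    · simp only [Bool.false_eq_true, if_false, Bool.xor_false] at *
      have hlt : i < nS A B C v - 1 := by omega
      rcases Nat.lt_or_ge (i + 1) (nS A B C v - 1) with h2 | h2
      · exact farS hT h14 hs (by omega) hx hmem
      · have e2 : nS A B C v - 1 = i + 1 := by omega
        rw [e2] at hmem hxe
        have := (adjS hT h14 hs i hx hmem).2
        exact neS hT h14 hs (i+1) (hxe.symm.trans this)
    · simp only [if_true, Bool.xor_self] at *
      rcases Nat.lt_or_ge 1 i with h2 | h2
      · exact farS hT h14 hs (by omega) hmem hx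
      · have e2 : i = 0 + 1 := by omega
        rw [e2] at hx
        have := (adjS hT h14 hs 0 hmem hx).1
        exact neS hT h14 hs 0 (this.symm.trans hxe)
  · intro v; unfold nS; omega
  · intro v x y hx hy
    exact hK _ _ _ (hx 0) (hy 0)
  · intro k x y h
    rwa [norm_sub_rev]
  · intro v i k x y h
    simp only [Function.iterate_succ_apply, Mf_Mi hC]
    exact h
  · intro x y h
    refine Mf_exp (K := K + K) hT.1 hT.2.1 hT.2.2.1 fun n => ?_
    obtain ⟨z, h1, h2⟩ := h n
    have : (Mf A B C)^[n] x - (Mf A B C)^[n] y =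
      ((Mf A B C)^[n] x - (Mf A B C)^[n] z) + ((Mf A B C)^[n] z - (Mf A B C)^[n] y) := by abel
    rw [this]
    exact (norm_add_le _ _).trans (add_le_add h1 h2)

noncomputable def lS (v : St) : ℝ :=
  if (v.1 0 - v.1 1) % 3 = 0 then 8 else if (v.1 0 - v.1 2) % 3 = 0 then 6
  else if (v.1 1 - v.1 2) % 3 = 0 then 7 else if (v.1 2 - v.1 3) % 3 = 0 then 6 else 5

theorem lS_ge (v : St) : 5 ≤ lS v := by
  unfold lS; split_ifs <;> norm_num

theorem lS_le (v : St) : lS v ≤ 8 := by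
  unfold lS; split_ifs <;> norm_num

theorem Off_ge (v : St) (m : ℕ) (hm : 0 < m) :
    lS (chS A B C v 0) + 5 * (m - 1 : ℝ) ≤ Off (chS A B C) lS v m := by
  unfold Off
  induction m with
  | zero => omega
  | succ m ih =>
    rw [Finset.sum_range_succ]
    rcases Nat.eq_zero_or_pos m with rfl | h
    · simp
    · have := ih h
      have := lS_ge (chS A B C v m)
      push_cast
      linarith

theorem lS_contr (hT : IsABCTile A B C T) (h14 : (Neighbors T).ncard = 14) (v : St) :
    lS v ≤ 7/8 * Off (chS A B C) lS v (nS A B C v) := by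
  have hAB := A_lt_B hT h14
  have hA := hT.1
  have hC := hT.2.2.1
  have hO := Off_ge (A := A) (B := B) (C := C) v (nS A B C v) (by unfold nS; omega)
  have hn1 : (1 : ℝ) ≤ nS A B C v := by unfold nS; push_cast; linarith [Nat.cast_nonneg (α := ℝ) (hi3 A B C v.1 - lo3 A B C v.1).toNat]
  have hm := lo3_mod (A := A) (B := B) (C := C) v.1
  have h5 := lS_ge (chS A B C v 0)
  have big : (lo3 A B C v.1 < hi3 A B C v.1) → lS v ≤ 7/8 * Off (chS A B C) lS v (nS A B C v) := by
    intro h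
    have : 2 ≤ nS A B C v := by unfold nS; omega
    have : (2 : ℝ) ≤ nS A B C v := by exact_mod_cast this
    have := lS_le v
    linarith
  have w1 : 0 ≤ C - B := by omega
  have w2 : 0 ≤ B - A := by omega
  have w3 : 0 ≤ A - 1 := by omega
  have b1 := mul_le_mul_of_nonneg_left (show (v.1 1 - v.1 0 - 1) / 3 ≤ (v.1 1 - v.1 0) / 3 by omega) w1
  have b2 := mul_le_mul_of_nonneg_left (show (v.1 2 - v.1 0 - 1) / 3 ≤ (v.1 2 - v.1 0) / 3 by omega) w2
  have b3 := mul_le_mul_of_nonneg_left (show (v.1 3 - v.1 0 - 1) / 3 ≤ (v.1 3 - v.1 0) / 3 by omega) w3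
  rcases S3_cases v.2 with H | H | H | H | H | H
  · apply big
    unfold Pr at H
    unfold lo3 hi3
    rw [show (v.1 1 - v.1 0) / 3 = (v.1 1 - v.1 0 - 1) / 3 + 1 by omega]
    linarith
  · apply big
    unfold Pr at H
    unfold lo3 hi3
    rw [show (v.1 2 - v.1 0) / 3 = (v.1 2 - v.1 0 - 1) / 3 + 1 by omega]
    linarith
  · unfold Pr at H
    have e1 : lS v = 5 := by
      unfold lS
      rw [if_neg (by omega), if_neg (by omega), if_neg (by omega), if_neg (by omega)]
    have e2 : lS (chS A B C v 0) = 6 := by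
      unfold lS
      have : (chS A B C v 0).1 = ![v.1 1, v.1 2, v.1 3, lo3 A B C v.1] := by simp [chS, cS]
      rw [this]
      simp
      rw [if_neg (by omega), if_neg (by omega), if_neg (by omega), if_pos (by omega)]
    linarith
  · unfold Pr at H
    have e1 : lS v = 7 := by
      unfold lS
      rw [if_neg (by omega), if_neg (by omega), if_pos (by omega)]
    have e2 : lS (chS A B C v 0) = 8 := by
      unfold lS
      have : (chS A B C v 0).1 = ![v.1 1, v.1 2, v.1 3, lo3 A B C v.1] := by simp [chS, cS]
      rw [this]
      simp
      omega
    linarith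
  · unfold Pr at H
    have e1 : lS v = 5 := by
      unfold lS
      rw [if_neg (by omega), if_neg (by omega), if_neg (by omega), if_neg (by omega)]
    have e2 : lS (chS A B C v 0) = 6 := by
      unfold lS
      have : (chS A B C v 0).1 = ![v.1 1, v.1 2, v.1 3, lo3 A B C v.1] := by simp [chS, cS]
      rw [this]
      simp
      rw [if_neg (by omega), if_pos (by omega)]
    linarith
  · unfold Pr at H
    have e1 : lS v = 6 := by
      unfold lS
      rw [if_neg (by omega), if_neg (by omega), if_neg (by omega), if_pos (by omega)]
    have e2 : lS (chS A B C v 0) = 7 := by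
      unfold lS
      have : (chS A B C v 0).1 = ![v.1 1, v.1 2, v.1 3, lo3 A B C v.1] := by simp [chS, cS]
      rw [this]
      simp
      rw [if_neg (by omega), if_neg (by omega), if_pos (by omega)]
    linarith

theorem arc3 (hT : IsABCTile A B C T) (h14 : (Neighbors T).ncard = 14) (v : St) :
    IsArc (EE T A B 3 v.1) (aS hT v false) (aS hT v true) := by
  obtain ⟨K, hK⟩ := In_bound hT
  exact sys_arc (tile_sys hT h14 K hK) (fun v => EE_compact hT 3 v.1) (fun _ _ => Mi_cont A B C)
    (fun v hv => nS_one (by simpa [spS] using hv)) (l := lS) (fun v => by linarith [lS_ge v]) lS_le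
    (lS_contr hT h14) v

end Arcs

section
variable {A B C : ℤ} {T : Set (Fin 3 → ℝ)}

/-- points in the tile with index `ind U` -/
def JJ (T : Set (Fin 3 → ℝ)) (A B : ℤ) (U : Finset (Fin 4)) : Set (Fin 3 → ℝ) :=
  {x | In T A B x (ind U)}

def E3 (T : Set (Fin 3 → ℝ)) (A B : ℤ) (U V : Finset (Fin 4)) : Set (Fin 3 → ℝ) :=
  JJ T A B ∅ ∩ JJ T A B U ∩ JJ T A B V

theorem E3_comm (U V : Finset (Fin 4)) : E3 T A B U V = E3 T A B V U := by
  unfold E3; ext x; simp only [Set.mem_inter_iff]; tauto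

theorem ind_cases (U : Finset (Fin 4)) (l : Fin 4) : (l ∈ U ∧ ind U l = 1) ∨ (l ∉ U ∧ ind U l = 0) := by
  unfold ind; by_cases h : l ∈ U <;> simp [h]

theorem E3_eq {U V : Finset (Fin 4)} (h : U ⊆ V) : E3 T A B U V = EE T A B 3 (ind U + ind V) := by
  ext x
  have key : ∀ l, ind U l ≤ ind V l ∧ 0 ≤ ind U l ∧ ind V l ≤ 1 ∧ ind ∅ l = 0 := by
    intro l
    have e : ind ∅ l = 0 := by simp [ind]
    rcases ind_cases U l with ⟨h1, h2⟩ | ⟨h1, h2⟩ <;> rcases ind_cases V l with ⟨h3, h4⟩ | ⟨h3, h4⟩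
    · omega
    · exact absurd (h h1) h3
    · omega
    · omega
  constructor
  · rintro ⟨⟨h0, h1⟩, h2⟩ t
    have ht : t % 3 = 0 ∨ t % 3 = 1 ∨ t % 3 = 2 := by omega
    rcases ht with ht | ht | ht
    · refine In_const h0 (t / 3) fun l => ?_
      have := key l
      simp only [Pi.add_apply]; omega
    · refine In_const h1 (t / 3) fun l => ?_
      have := key l
      simp only [Pi.add_apply]; omega
    · refine In_const h2 (t / 3) fun l => ?_
      have := key l
      simp only [Pi.add_apply]; omega
  · intro hx
    refine ⟨⟨In_const (hx 0) 0 fun l => ?_, In_const (hx 1) 0 fun l => ?_⟩, In_const (hx 2) 0 fun l => ?_⟩ <;>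
    · have := key l
      simp only [Pi.add_apply]; omega

/-- the four-fold point belonging to a flag -/
def kk (a b c : Fin 4) : Fin 4 → ℤ := ind {a} + ind {a, b} + ind {a, b, c}

theorem In_kk {a b c : Fin 4} {x : Fin 3 → ℝ} (h0 : x ∈ JJ T A B ∅) (h1 : x ∈ JJ T A B {a})
    (h2 : x ∈ JJ T A B {a, b}) (h3 : x ∈ JJ T A B {a, b, c}) : x ∈ EE T A B 4 (kk a b c) := by
  have key : ∀ l, ind {a} l ≤ ind {a, b} l ∧ ind {a, b} l ≤ ind {a, b, c} l ∧
      0 ≤ ind {a} l ∧ ind {a, b, c} l ≤ 1 ∧ ind ∅ l = 0 := by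
    intro l
    have e : ind ∅ l = 0 := by simp [ind]
    rcases ind_cases {a} l with ⟨g1, g2⟩ | ⟨g1, g2⟩ <;>
    rcases ind_cases {a, b} l with ⟨g3, g4⟩ | ⟨g3, g4⟩ <;>
    rcases ind_cases {a, b, c} l with ⟨g5, g6⟩ | ⟨g5, g6⟩ <;>
    first
    | omega
    | (exfalso; simp at g1 g3 g5; tauto)
  intro t
  have ht : t % 4 = 0 ∨ t % 4 = 1 ∨ t % 4 = 2 ∨ t % 4 = 3 := by omega
  rcases ht with ht | ht | ht | ht
  · refine In_const h0 (t / 4) fun l => ?_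
    have := key l
    simp only [Pi.add_apply, kk]; omega
  · refine In_const h1 (t / 4) fun l => ?_
    have := key l
    simp only [Pi.add_apply, kk]; omega
  · refine In_const h2 (t / 4) fun l => ?_
    have := key l
    simp only [Pi.add_apply, kk]; omega
  · refine In_const h3 (t / 4) fun l => ?_
    have := key l
    simp only [Pi.add_apply, kk]; omega

def Dis (a b c d : Fin 4) : Prop := a ≠ b ∧ a ≠ c ∧ a ≠ d ∧ b ≠ c ∧ b ≠ d ∧ c ≠ d

instance (a b c d : Fin 4) : Decidable (Dis a b c d) := by unfold Dis; infer_instance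

instance (k : Fin 4 → ℤ) : Decidable (D4 k) := by unfold D4; infer_instance

theorem D4_kk : ∀ a b c d : Fin 4, Dis a b c d → D4 (kk a b c) := by decide +kernel

noncomputable def vv (hT : IsABCTile A B C T) (a b c : Fin 4) : Fin 3 → ℝ := pt hT (kk a b c)

theorem vv_eq (hT : IsABCTile A B C T) (h14 : (Neighbors T).ncard = 14) {a b c d : Fin 4}
    (hd : Dis a b c d) {x : Fin 3 → ℝ} (hx : x ∈ EE T A B 4 (kk a b c)) : x = vv hT a b c :=
  EE4_unique hT h14 (D4_kk a b c d hd) hx (pt_mem hT _)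

theorem JJ_incomp (hT : IsABCTile A B C T) (h14 : (Neighbors T).ncard = 14) {U V : Finset (Fin 4)}
    {x : Fin 3 → ℝ} (hU : x ∈ JJ T A B U) (hV : x ∈ JJ T A B V) : U ⊆ V ∨ V ⊆ U := by
  by_contra hcon
  push Not at hcon
  obtain ⟨h1, h2⟩ := hcon
  obtain ⟨a, ha, ha'⟩ := Finset.not_subset.1 h1
  obtain ⟨b, hb, hb'⟩ := Finset.not_subset.1 h2
  have := F3 hT h14 hU hV a b
  simp [ind, ha, ha', hb, hb'] at this

/-- same up to a constant -/
def eqc (k k' : Fin 4 → ℤ) : Prop :=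
  k' 1 - k 1 = k' 0 - k 0 ∧ k' 2 - k 2 = k' 0 - k 0 ∧ k' 3 - k 3 = k' 0 - k 0

instance (k k' : Fin 4 → ℤ) : Decidable (eqc k k') := by unfold eqc; infer_instance

theorem EE_eqc {m : ℤ} {k k' : Fin 4 → ℤ} (h : eqc k k') {x : Fin 3 → ℝ} (hx : x ∈ EE T A B m k) :
    x ∈ EE T A B m k' := by
  unfold eqc at h
  exact EE_const (k' 0 - k 0) (by omega) (by omega) (by omega) (by omega) hx

theorem S3_of {h : Fin 4 → ℤ} (g : ∃ a b c : Fin 4, h a = 0 ∧ h b = 1 ∧ h c = 2) : S3 h := by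
  obtain ⟨a, b, c, ha, hb, hc⟩ := g
  intro r
  have : ∃ l, (h l - r) % 3 = 0 := by
    have ht : r % 3 = 0 ∨ r % 3 = 1 ∨ r % 3 = 2 := by omega
    rcases ht with ht | ht | ht
    · exact ⟨a, by omega⟩
    · exact ⟨b, by omega⟩
    · exact ⟨c, by omega⟩
  obtain ⟨l, hl⟩ := this
  fin_cases l <;> simp at hl <;> omega

/-- combinatorial data for an arc between two flags -/
def Arcd (h k k' : Fin 4 → ℤ) : Prop :=
  (∃ a b c : Fin 4, h a = 0 ∧ h b = 1 ∧ h c = 2) ∧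
  ((eqc (Kp h (jj h)) k ∧ eqc (Km h (jj h)) k') ∨ (eqc (Kp h (jj h)) k' ∧ eqc (Km h (jj h)) k))

instance (h k k' : Fin 4 → ℤ) : Decidable (Arcd h k k') := by unfold Arcd; infer_instance

theorem arcd1 : ∀ a b c d : Fin 4, Dis a b c d → Arcd (ind {a} + ind {a, b}) (kk a b c) (kk a b d) := by
  decide +kernel

theorem arcd2 : ∀ a b c d : Fin 4, Dis a b c d → Arcd (ind {a} + ind {a, b, c}) (kk a b c) (kk a c b) := by
  decide +kernel

theorem arcd3 : ∀ a b c d : Fin 4, Dis a b c d → Arcd (ind {a, b} + ind {a, b, c}) (kk a b c) (kk b a c) := by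
  decide +kernel

theorem Arcd_arc (hT : IsABCTile A B C T) (h14 : (Neighbors T).ncard = 14) {h : Fin 4 → ℤ}
    {a b c d a' b' c' d' : Fin 4} (hd : Dis a b c d) (hd' : Dis a' b' c' d')
    (H : Arcd h (kk a b c) (kk a' b' c')) :
    IsArc (EE T A B 3 h) (vv hT a b c) (vv hT a' b' c') := by
  obtain ⟨h1, h2⟩ := H
  have arc := arc3 hT h14 ⟨h, S3_of h1⟩
  have e1 := aS_true hT ⟨h, S3_of h1⟩
  have e2 := aS_false hT ⟨h, S3_of h1⟩
  rcases h2 with ⟨g1, g2⟩ | ⟨g1, g2⟩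
  · rw [← vv_eq hT h14 hd (EE_eqc g1 e1), ← vv_eq hT h14 hd' (EE_eqc g2 e2)]
    exact arc.symm
  · rw [← vv_eq hT h14 hd' (EE_eqc g1 e1), ← vv_eq hT h14 hd (EE_eqc g2 e2)]
    exact arc

theorem arcE1 (hT : IsABCTile A B C T) (h14 : (Neighbors T).ncard = 14) {a b c d : Fin 4}
    (hd : Dis a b c d) : IsArc (E3 T A B {a} {a, b}) (vv hT a b c) (vv hT a b d) := by
  rw [E3_eq (by simp)]
  exact Arcd_arc hT h14 hd (d' := c) (by unfold Dis at *; tauto) (arcd1 a b c d hd)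

theorem arcE2 (hT : IsABCTile A B C T) (h14 : (Neighbors T).ncard = 14) {a b c d : Fin 4}
    (hd : Dis a b c d) : IsArc (E3 T A B {a} {a, b, c}) (vv hT a b c) (vv hT a c b) := by
  rw [E3_eq (by simp)]
  exact Arcd_arc hT h14 hd (d' := d) (by unfold Dis at *; tauto) (arcd2 a b c d hd)

theorem arcE3 (hT : IsABCTile A B C T) (h14 : (Neighbors T).ncard = 14) {a b c d : Fin 4}
    (hd : Dis a b c d) : IsArc (E3 T A B {a, b} {a, b, c}) (vv hT a b c) (vv hT b a c) := by
  rw [E3_eq (by intro x; simp; tauto)]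
  exact Arcd_arc hT h14 hd (d' := d) (by unfold Dis at *; tauto) (arcd3 a b c d hd)

theorem hexagon {E : Type*} [TopologicalSpace E] [T2Space E] {S1 S2 S3 S4 S5 S6 : Set E} {p1 p2 p3 p4 p5 p6 : E}
    (h1 : IsArc S1 p1 p2) (h2 : IsArc S2 p2 p3) (h3 : IsArc S3 p3 p4)
    (h4 : IsArc S4 p4 p5) (h5 : IsArc S5 p5 p6) (h6 : IsArc S6 p6 p1)
    (i12 : ∀ x ∈ S1, x ∈ S2 → x = p2) (i23 : ∀ x ∈ S2, x ∈ S3 → x = p3)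
    (i34 : ∀ x ∈ S3, x ∈ S4 → x = p4) (i45 : ∀ x ∈ S4, x ∈ S5 → x = p5)
    (i56 : ∀ x ∈ S5, x ∈ S6 → x = p6) (i61 : ∀ x ∈ S6, x ∈ S1 → x = p1)
    (i13 : ∀ x ∈ S1, x ∉ S3) (i14 : ∀ x ∈ S1, x ∉ S4) (i15 : ∀ x ∈ S1, x ∉ S5)
    (i24 : ∀ x ∈ S2, x ∉ S4) (i25 : ∀ x ∈ S2, x ∉ S5) (i26 : ∀ x ∈ S2, x ∉ S6)
    (i35 : ∀ x ∈ S3, x ∉ S5) (i36 : ∀ x ∈ S3, x ∉ S6) (i46 : ∀ x ∈ S4, x ∉ S6) :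
    Nonempty ((((S1 ∪ S2) ∪ S3) ∪ ((S4 ∪ S5) ∪ S6) : Set E) ≃ₜ
      Metric.sphere (0 : EuclideanSpace ℝ (Fin 2)) 1) := by
  have g1 := (h1.concat h2 i12).concat h3 (by
    rintro x (hx | hx) hx'
    · exact absurd hx' (i13 x hx)
    · exact i23 x hx hx')
  have g2 := (h4.concat h5 i45).concat h6 (by
    rintro x (hx | hx) hx'
    · exact absurd hx' (i46 x hx)
    · exact i56 x hx hx')
  refine g1.closed g2 ?_
  rintro x ((hx | hx) | hx) ((hx' | hx') | hx')
  · exact absurd hx' (i14 x hx)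
  · exact absurd hx' (i15 x hx)
  · exact Or.inl (i61 x hx' hx)
  · exact absurd hx' (i24 x hx)
  · exact absurd hx' (i25 x hx)
  · exact absurd hx' (i26 x hx)
  · exact Or.inr (i34 x hx hx')
  · exact absurd hx' (i35 x hx)
  · exact absurd hx' (i36 x hx)

theorem square {E : Type*} [TopologicalSpace E] [T2Space E] {S1 S2 S3 S4 : Set E} {p1 p2 p3 p4 : E}
    (h1 : IsArc S1 p1 p2) (h2 : IsArc S2 p2 p3) (h3 : IsArc S3 p3 p4) (h4 : IsArc S4 p4 p1)
    (i12 : ∀ x ∈ S1, x ∈ S2 → x = p2) (i23 : ∀ x ∈ S2, x ∈ S3 → x = p3)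
    (i34 : ∀ x ∈ S3, x ∈ S4 → x = p4) (i41 : ∀ x ∈ S4, x ∈ S1 → x = p1)
    (i13 : ∀ x ∈ S1, x ∉ S3) (i24 : ∀ x ∈ S2, x ∉ S4) :
    Nonempty (((S1 ∪ S2) ∪ (S3 ∪ S4) : Set E) ≃ₜ
      Metric.sphere (0 : EuclideanSpace ℝ (Fin 2)) 1) := by
  refine (h1.concat h2 i12).closed (h3.concat h4 i34) ?_
  rintro x (hx | hx) (hx' | hx')
  · exact absurd hx' (i13 x hx)
  · exact Or.inl (i41 x hx' hx)
  · exact Or.inr (i23 x hx hx')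
  · exact absurd hx' (i24 x hx)

end

section
variable {A B C : ℤ} {T : Set (Fin 3 → ℝ)}

def LL (T : Set (Fin 3 → ℝ)) (A B : ℤ) (U : Finset (Fin 4)) : Set (Fin 3 → ℝ) :=
  ⋃ V ∈ {V : Finset (Fin 4) | V ∈ props ∧ V ≠ U}, E3 T A B U V

theorem E3_no (hT : IsABCTile A B C T) (h14 : (Neighbors T).ncard = 14) {U V W : Finset (Fin 4)}
    (h1 : ¬ V ⊆ W) (h2 : ¬ W ⊆ V) : ∀ x ∈ E3 T A B U V, x ∉ E3 T A B U W := by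
  intro x hx hx'
  rcases JJ_incomp hT h14 hx.2 hx'.2 with h | h
  · exact h1 h
  · exact h2 h

theorem E3_vv (hT : IsABCTile A B C T) (h14 : (Neighbors T).ncard = 14) {U V W : Finset (Fin 4)}
    (a b c d : Fin 4) (hd : Dis a b c d) (h1 : {a} = U ∨ {a} = V ∨ {a} = W)
    (h2 : {a, b} = U ∨ {a, b} = V ∨ {a, b} = W) (h3 : {a, b, c} = U ∨ {a, b, c} = V ∨ {a, b, c} = W) :
    ∀ x ∈ E3 T A B U V, x ∈ E3 T A B U W → x = vv hT a b c := by
  intro x hx hx'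
  have key : ∀ X, (X = U ∨ X = V ∨ X = W) → x ∈ JJ T A B X := by
    rintro X (rfl | rfl | rfl)
    · exact hx.1.2
    · exact hx.2
    · exact hx'.2
  exact vv_eq hT h14 hd (In_kk hx.1.1 (key _ h1) (key _ h2) (key _ h3))

theorem LL_eq (hT : IsABCTile A B C T) (h14 : (Neighbors T).ncard = 14) {U : Finset (Fin 4)}
    {S : Set (Fin 3 → ℝ)} (L : List (Finset (Fin 4)))
    (h : ∀ V, V ∈ L ↔ (V ∈ props ∧ V ≠ U ∧ (U ⊆ V ∨ V ⊆ U)))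
    (hS : ∀ x, x ∈ S ↔ ∃ V ∈ L, x ∈ E3 T A B U V) : LL T A B U = S := by
  ext x
  rw [hS]
  simp only [LL, Set.mem_iUnion, Set.mem_ofPred_eq]
  constructor
  · rintro ⟨V, ⟨h1, h2⟩, hx⟩
    exact ⟨V, (h V).2 ⟨h1, h2, JJ_incomp hT h14 hx.1.2 hx.2⟩, hx⟩
  · rintro ⟨V, hV, hx⟩
    obtain ⟨h1, h2, -⟩ := (h V).1 hV
    exact ⟨V, ⟨h1, h2⟩, hx⟩

theorem list3 : ∀ a b c d : Fin 4, Dis a b c d → ∀ V, V ∈ [{a}, {a, b}, {b}, {b, c}, {c}, {c, a}] ↔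
    (V ∈ props ∧ V ≠ {a, b, c} ∧ ({a, b, c} ⊆ V ∨ V ⊆ {a, b, c})) := by
  decide +kernel

theorem list1 : ∀ a b c d : Fin 4, Dis a b c d → ∀ V,
    V ∈ [{d, a}, {d, a, b}, {d, b}, {d, b, c}, {d, c}, {d, c, a}] ↔
    (V ∈ props ∧ V ≠ {d} ∧ ({d} ⊆ V ∨ V ⊆ {d})) := by
  decide +kernel

theorem list2 : ∀ a b c d : Fin 4, Dis a b c d → ∀ V,
    V ∈ [{a}, {a, b, d}, {b}, {a, b, c}] ↔
    (V ∈ props ∧ V ≠ {a, b} ∧ ({a, b} ⊆ V ∨ V ⊆ {a, b})) := by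
  decide +kernel

theorem perm3 (a b c : Fin 4) : ({a, c, b} : Finset (Fin 4)) = {a, b, c} ∧ ({b, a, c} : Finset (Fin 4)) = {a, b, c} ∧
    ({b, c, a} : Finset (Fin 4)) = {a, b, c} ∧ ({c, a, b} : Finset (Fin 4)) = {a, b, c} ∧
    ({c, b, a} : Finset (Fin 4)) = {a, b, c} := by
  refine ⟨?_, ?_, ?_, ?_, ?_⟩ <;> (ext x; simp only [Finset.mem_insert, Finset.mem_singleton]; tauto)

theorem loop3 (hT : IsABCTile A B C T) (h14 : (Neighbors T).ncard = 14) {a b c d : Fin 4}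
    (hd : Dis a b c d) : Nonempty (LL T A B {a, b, c} ≃ₜ Metric.sphere (0 : EuclideanSpace ℝ (Fin 2)) 1) := by
  have hLL := LL_eq (T := T) hT h14 (U := {a, b, c}) (S := ((E3 T A B {a, b, c} {a} ∪ E3 T A B {a, b, c} {a, b}) ∪ E3 T A B {a, b, c} {b}) ∪
    ((E3 T A B {a, b, c} {b, c} ∪ E3 T A B {a, b, c} {c}) ∪ E3 T A B {a, b, c} {c, a})) [{a}, {a, b}, {b}, {b, c}, {c}, {c, a}] (list3 a b c d hd)
    (by intro x; simp only [Set.mem_union, List.mem_cons, List.not_mem_nil, or_false, exists_eq_or_imp, exists_eq_left, or_assoc])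
  rw [hLL]
  obtain ⟨q1, q2, q3, q4, q5⟩ := perm3 a b c
  have hd2 : Dis b a c d := by unfold Dis at *; tauto
  have hd3 : Dis b c a d := by unfold Dis at *; tauto
  have hd4 : Dis c b a d := by unfold Dis at *; tauto
  have hd5 : Dis c a b d := by unfold Dis at *; tauto
  have hd6 : Dis a c b d := by unfold Dis at *; tauto
  have k1 := (arcE2 hT h14 hd).symm
  have k2 := arcE3 hT h14 hd
  have k3 := arcE2 hT h14 hd2
  have k4 := arcE3 hT h14 hd3
  have k5 := arcE2 hT h14 hd4
  have k6 := arcE3 hT h14 hd5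
  rw [q2] at k3
  rw [q3] at k4
  rw [q5] at k5
  rw [q4] at k6
  rw [E3_comm] at k1 k2 k3 k4 k5 k6
  unfold Dis at hd
  refine hexagon k1 k2 k3 k4 k5 k6
    (E3_vv hT h14 a b c d hd ?_ ?_ ?_) (E3_vv hT h14 b a c d hd2 ?_ ?_ ?_)
    (E3_vv hT h14 b c a d hd3 ?_ ?_ ?_) (E3_vv hT h14 c b a d hd4 ?_ ?_ ?_)
    (E3_vv hT h14 c a b d hd5 ?_ ?_ ?_) (E3_vv hT h14 a c b d hd6 ?_ ?_ ?_)
    (E3_no hT h14 ?_ ?_) (E3_no hT h14 ?_ ?_) (E3_no hT h14 ?_ ?_) (E3_no hT h14 ?_ ?_) (E3_no hT h14 ?_ ?_)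
    (E3_no hT h14 ?_ ?_) (E3_no hT h14 ?_ ?_) (E3_no hT h14 ?_ ?_) (E3_no hT h14 ?_ ?_)
  all_goals first
    | (simp [Finset.insert_subset_iff, q1, q2, q3, q4, q5, Finset.pair_comm]; done)
    | (simp only [Finset.insert_subset_iff, Finset.singleton_subset_iff, Finset.mem_insert,
        Finset.mem_singleton]; tauto)

theorem loop1 (hT : IsABCTile A B C T) (h14 : (Neighbors T).ncard = 14) {a b c d : Fin 4}
    (hd : Dis a b c d) : Nonempty (LL T A B {d} ≃ₜ Metric.sphere (0 : EuclideanSpace ℝ (Fin 2)) 1) := by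
  have hLL := LL_eq (T := T) hT h14 (U := {d}) (S := ((E3 T A B {d} {d, a} ∪ E3 T A B {d} {d, a, b}) ∪ E3 T A B {d} {d, b}) ∪
    ((E3 T A B {d} {d, b, c} ∪ E3 T A B {d} {d, c}) ∪ E3 T A B {d} {d, c, a})) [{d, a}, {d, a, b}, {d, b}, {d, b, c}, {d, c}, {d, c, a}] (list1 a b c d hd)
    (by intro x; simp only [Set.mem_union, List.mem_cons, List.not_mem_nil, or_false, exists_eq_or_imp, exists_eq_left, or_assoc])
  rw [hLL]
  have hd1 : Dis d a b c := by unfold Dis at *; tauto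
  have hd2 : Dis d b a c := by unfold Dis at *; tauto
  have hd3 : Dis d b c a := by unfold Dis at *; tauto
  have hd4 : Dis d c b a := by unfold Dis at *; tauto
  have hd5 : Dis d c a b := by unfold Dis at *; tauto
  have hd6 : Dis d a c b := by unfold Dis at *; tauto
  have k1 := (arcE1 hT h14 hd1).symm
  have k2 := arcE2 hT h14 hd1
  have k3 := arcE1 hT h14 hd2
  have k4 := arcE2 hT h14 hd3
  have k5 := arcE1 hT h14 hd4
  have k6 := arcE2 hT h14 hd5
  have q1 := (perm3 d a b).1
  have q2 := (perm3 d b c).1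
  have q3 := (perm3 d c a).1
  unfold Dis at hd
  refine hexagon k1 k2 k3 k4 k5 k6
    (E3_vv hT h14 _ _ _ _ hd1 ?_ ?_ ?_) (E3_vv hT h14 _ _ _ _ hd2 ?_ ?_ ?_)
    (E3_vv hT h14 _ _ _ _ hd3 ?_ ?_ ?_) (E3_vv hT h14 _ _ _ _ hd4 ?_ ?_ ?_)
    (E3_vv hT h14 _ _ _ _ hd5 ?_ ?_ ?_) (E3_vv hT h14 _ _ _ _ hd6 ?_ ?_ ?_)
    (E3_no hT h14 ?_ ?_) (E3_no hT h14 ?_ ?_) (E3_no hT h14 ?_ ?_) (E3_no hT h14 ?_ ?_) (E3_no hT h14 ?_ ?_)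
    (E3_no hT h14 ?_ ?_) (E3_no hT h14 ?_ ?_) (E3_no hT h14 ?_ ?_) (E3_no hT h14 ?_ ?_)
  all_goals first
    | (simp [Finset.insert_subset_iff, q1, q2, q3, Finset.pair_comm]; done)
    | (simp only [Finset.insert_subset_iff, Finset.singleton_subset_iff, Finset.mem_insert,
        Finset.mem_singleton]; tauto)

theorem loop2 (hT : IsABCTile A B C T) (h14 : (Neighbors T).ncard = 14) {a b c d : Fin 4}
    (hd : Dis a b c d) : Nonempty (LL T A B {a, b} ≃ₜ Metric.sphere (0 : EuclideanSpace ℝ (Fin 2)) 1) := by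
  have hLL := LL_eq (T := T) hT h14 (U := {a, b}) (S := (E3 T A B {a, b} {a} ∪ E3 T A B {a, b} {a, b, d}) ∪
    (E3 T A B {a, b} {b} ∪ E3 T A B {a, b} {a, b, c})) [{a}, {a, b, d}, {b}, {a, b, c}] (list2 a b c d hd)
    (by intro x; simp only [Set.mem_union, List.mem_cons, List.not_mem_nil, or_false, exists_eq_or_imp, exists_eq_left, or_assoc])
  rw [hLL]
  have hd1 : Dis a b d c := by unfold Dis at *; tauto
  have hd2 : Dis b a d c := by unfold Dis at *; tauto
  have hd3 : Dis b a c d := by unfold Dis at *; tauto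
  have k1 := arcE1 hT h14 hd
  have k2 := arcE3 hT h14 hd1
  have k3 := arcE1 hT h14 hd2
  have k4 := arcE3 hT h14 hd3
  have q1 := (perm3 a b c).2.1
  have q2 := (perm3 a b d).2.1
  have q3 := Finset.pair_comm b a
  rw [q3] at k3
  rw [q3, q1] at k4
  rw [E3_comm] at k1 k3
  unfold Dis at hd
  refine square k1 k2 k3 k4
    (E3_vv hT h14 _ _ _ _ hd1 ?_ ?_ ?_) (E3_vv hT h14 _ _ _ _ hd2 ?_ ?_ ?_)
    (E3_vv hT h14 _ _ _ _ hd3 ?_ ?_ ?_) (E3_vv hT h14 a b c d hd ?_ ?_ ?_)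
    (E3_no hT h14 ?_ ?_) (E3_no hT h14 ?_ ?_)
  all_goals first
    | (simp [Finset.insert_subset_iff, q1, q2, q3]; done)
    | (simp only [Finset.insert_subset_iff, Finset.singleton_subset_iff, Finset.mem_insert,
        Finset.mem_singleton]; tauto)

theorem props_cases : ∀ U ∈ props, ∃ a b c d : Fin 4, Dis a b c d ∧ (U = {d} ∨ U = {a, b} ∨ U = {a, b, c}) := by
  decide +kernel

theorem loop (hT : IsABCTile A B C T) (h14 : (Neighbors T).ncard = 14) {U : Finset (Fin 4)}
    (hU : U ∈ props) : Nonempty (LL T A B U ≃ₜ Metric.sphere (0 : EuclideanSpace ℝ (Fin 2)) 1) := by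
  obtain ⟨a, b, c, d, hd, rfl | rfl | rfl⟩ := props_cases U hU
  · exact loop1 hT h14 hd
  · exact loop2 hT h14 hd
  · exact loop3 hT h14 hd

theorem mem_tr {x v : Fin 3 → ℝ} : x ∈ tileTranslate v T ↔ x - v ∈ T := by
  unfold tileTranslate
  constructor
  · rintro ⟨y, hy, rfl⟩
    simpa using hy
  · intro h
    exact ⟨x - v, h, by simp⟩

theorem mem_JJ0 {x : Fin 3 → ℝ} : x ∈ JJ T A B ∅ ↔ x ∈ T := by
  have e : ind ∅ = 0 := by funext l; simp [ind]
  have e2 : toR 0 = 0 := by funext l; simp [toR]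
  simp [JJ, In, e, vz_zero, e2]

theorem LL_final (hT : IsABCTile A B C T) (h14 : (Neighbors T).ncard = 14) {U : Finset (Fin 4)}
    (hU : U ∈ props) : (⋃ β ∈ {β : Fin 3 → ℤ | β ∉ ({0, vz A B (ind U)} : Set (Fin 3 → ℤ))},
      T ∩ tileTranslate (toR (vz A B (ind U))) T ∩ tileTranslate (toR β) T) = LL T A B U := by
  ext x
  simp only [LL, Set.mem_iUnion, Set.mem_ofPred_eq, E3, Set.mem_inter_iff, mem_JJ0, mem_tr]
  simp only [JJ, In, Set.mem_ofPred_eq]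
  have h0 : ∀ V ∈ props, vz A B (ind V) ∈ Neighbors T := fun V hV => by
    rw [nbr_eq hT h14]; exact ⟨V, hV, rfl⟩
  constructor
  · rintro ⟨β, hβ, ⟨hx1, hx2⟩, hx3⟩
    simp only [Set.mem_insert_iff, Set.mem_singleton_iff, not_or] at hβ
    have hn : β ∈ Neighbors T := ⟨hβ.1, x, hx1, mem_tr.2 hx3⟩
    rw [nbr_eq hT h14] at hn
    obtain ⟨V, hV, rfl⟩ := hn
    refine ⟨V, ⟨hV, ?_⟩, ⟨hx1, hx2⟩, hx3⟩
    rintro rfl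
    exact hβ.2 rfl
  · rintro ⟨V, ⟨hV, hVU⟩, ⟨hx1, hx2⟩, hx3⟩
    refine ⟨vz A B (ind V), ?_, ⟨hx1, hx2⟩, hx3⟩
    simp only [Set.mem_insert_iff, Set.mem_singleton_iff, not_or]
    refine ⟨(h0 V hV).1, fun he => hVU ?_⟩
    rw [vz_eq_iff] at he
    exact ind_inj V hV U hU he

end

theorem stmt16 (A B C : ℤ) (T : Set (Fin 3 → ℝ)) (hT : IsABCTile A B C T)
    (h14 : (Neighbors T).ncard = 14) (α : Fin 3 → ℤ) (hα : α ∈ Neighbors T) :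
    Nonempty (((⋃ β ∈ {β : Fin 3 → ℤ | β ∉ ({0, α} : Set (Fin 3 → ℤ))},
      T ∩ tileTranslate (toR α) T ∩ tileTranslate (toR β) T) : Set (Fin 3 → ℝ)) ≃ₜ
      Metric.sphere (0 : EuclideanSpace ℝ (Fin 2)) 1) := by
  rw [nbr_eq hT h14] at hα
  obtain ⟨U, hU, rfl⟩ := hα
  simp only
  rw [LL_final hT h14 hU]
  exact loop hT h14 hU
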